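/- arXiv:1612.03390 — 2 statements merged into one kernel-verified Lean document; each statement's English description precedes it below -/
import Mathlib

section
/- Let n ∈ ℕ with n ≥ 1 and β ∈ (0,1]. Let C^{n,β−}_0(ℝ^d,ℝ^d) := ⋂_{0<α<β} C^{n,α}_0(ℝ^d,ℝ^d), equipped with the Fréchet topology generated by the seminorms ‖·‖_{n,α}, 0 < α < β, and let D^{n,β−}(ℝ^d) := { Id + φ : φ ∈ C^{n,β−}_0(ℝ^d,ℝ^d), det d(Id+φ)(x) > 0 for all x ∈ ℝ^d }, with the topology induced from C^{n,β−}_0(ℝ^d,ℝ^d) via Φ ↦ Φ − Id. Then D^{n,β−}(ℝ^d) is a topological group under composition: composition (Φ,Ψ) ↦ Φ∘Ψ and inversion Φ ↦ Φ⁻¹ are continuous in this topology. -/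
open Function Set Filter Topology MeasureTheory
open scoped ENNReal NNReal

noncomputable section

section Defs

variable {E F : Type*} [NormedAddCommGroup E] [NormedSpace ℝ E]
  [NormedAddCommGroup F] [NormedSpace ℝ F]

/-- `‖f‖_n = max_{0 ≤ l ≤ n} sup_x ‖f⁽ˡ⁾(x)‖`, as an extended real. -/
def eCnb (n : ℕ) (f : E → F) : ℝ≥0∞ :=
  ⨆ (l : Fin (n + 1)) (x : E), (‖iteratedFDeriv ℝ (l : ℕ) f x‖₊ : ℝ≥0∞)

/-- The Hölder seminorm `[f]_{n,α}`, as an extended real. -/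
def eHsemi (n : ℕ) (α : ℝ) (f : E → F) : ℝ≥0∞ :=
  ⨆ (x : E) (y : E) (_ : x ≠ y),
    (‖iteratedFDeriv ℝ n f x - iteratedFDeriv ℝ n f y‖₊ : ℝ≥0∞) / edist x y ^ α

/-- The Hölder norm `‖f‖_{n,α} = max(‖f‖_n, [f]_{n,α})`, as an extended real. -/
def eHnorm (n : ℕ) (α : ℝ) (f : E → F) : ℝ≥0∞ := max (eCnb n f) (eHsemi n α f)

/-- The Hölder norm `‖f‖_{n,α}` as a real number (junk value `0` when infinite). -/
def hnorm (n : ℕ) (α : ℝ) (f : E → F) : ℝ := (eHnorm n α f).toReal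

/-- Membership in the global Hölder space `C^{n,α}_b(E,F)`. -/
def MemCb (n : ℕ) (α : ℝ) (f : E → F) : Prop :=
  ContDiff ℝ (n : ℕ∞) f ∧ eHnorm n α f < ⊤

/-- Membership in `C^{n,α}_0(E,F)`: moreover all derivatives up to order `n`
vanish at infinity. -/
def MemC0 (n : ℕ) (α : ℝ) (f : E → F) : Prop :=
  MemCb n α f ∧
    ∀ l ≤ n, Tendsto (fun x => ‖iteratedFDeriv ℝ l f x‖) (cocompact E) (𝓝 0)

end Defs

/-- `ℝ^d` -/
abbrev Euc (d : ℕ) : Type := EuclideanSpace ℝ (Fin d)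

/-- Membership in the diffeomorphism group `D^{n,β}(ℝ^d)`:
`Φ - Id ∈ C^{n,β}_0` and `det dΦ(x) > 0` everywhere. -/
def MemD (d n : ℕ) (β : ℝ) (Φ : Euc d → Euc d) : Prop :=
  MemC0 n β (fun x => Φ x - x) ∧
    ∀ x, 0 < LinearMap.det ((fderiv ℝ Φ x : Euc d →L[ℝ] Euc d) : Euc d →ₗ[ℝ] Euc d)

end

/-- Membership in `C^{n,β−}_0(ℝ^d,ℝ^d) = ⋂_{0<α<β} C^{n,α}_0(ℝ^d,ℝ^d)`. -/
def MemC0minus {E F : Type*} [NormedAddCommGroup E] [NormedSpace ℝ E]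
    [NormedAddCommGroup F] [NormedSpace ℝ F] (n : ℕ) (β : ℝ) (f : E → F) : Prop :=
  ∀ α : ℝ, 0 < α → α < β → MemC0 n α f

/-- Membership in `D^{n,β−}(ℝ^d)`. -/
def MemDminus (d n : ℕ) (β : ℝ) (Φ : Euc d → Euc d) : Prop :=
  MemC0minus n β (fun x => Φ x - x) ∧
    ∀ x, 0 < LinearMap.det ((fderiv ℝ Φ x : Euc d →L[ℝ] Euc d) : Euc d →ₗ[ℝ] Euc d)


section HolderBounds

universe u

variable {E : Type u} [NormedAddCommGroup E] [NormedSpace ℝ E]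
variable {F G H : Type u} [NormedAddCommGroup F] [NormedSpace ℝ F]
  [NormedAddCommGroup G] [NormedSpace ℝ G] [NormedAddCommGroup H] [NormedSpace ℝ H]

/-- `f` is `n` times differentiable, the derivatives of order at most `n` are bounded by `R`, and
the last one is `α`-Hölder with constant `R`. -/
def HolderBdd : (n : ℕ) → {F : Type u} → [NormedAddCommGroup F] → [NormedSpace ℝ F] →
    (α R : ℝ) → (E → F) → Prop
  | 0, _, _, _, α, R, f => (∀ x, ‖f x‖ ≤ R) ∧ ∀ x y, ‖f x - f y‖ ≤ R * ‖x - y‖ ^ α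
  | n + 1, _, _, _, α, R, f =>
    Differentiable ℝ f ∧ (∀ x, ‖f x‖ ≤ R) ∧ HolderBdd n α R (fderiv ℝ f)

namespace HolderBdd

lemma norm_le {n : ℕ} {α R : ℝ} {f : E → F} (h : HolderBdd n α R f) (x : E) : ‖f x‖ ≤ R := by
  cases n with
  | zero => exact h.1 x
  | succ n => exact h.2.1 x

lemma nonneg {n : ℕ} {α R : ℝ} {f : E → F} (h : HolderBdd n α R f) : 0 ≤ R :=
  (norm_nonneg _).trans (h.norm_le 0)

lemma mono {n : ℕ} {α R S : ℝ} {f : E → F} (h : HolderBdd n α R f) (hRS : R ≤ S) :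
    HolderBdd n α S f := by
  induction n generalizing F with
  | zero =>
    exact ⟨fun x => (h.1 x).trans hRS, fun x y => (h.2 x y).trans (by gcongr)⟩
  | succ n ih => exact ⟨h.1, fun x => (h.2.1 x).trans hRS, ih h.2.2⟩

lemma const (n : ℕ) (α : ℝ) (c : F) : HolderBdd n α ‖c‖ (fun _ : E => c) := by
  induction n generalizing F with
  | zero => exact ⟨fun _ => le_rfl, fun x y => by simp; positivity⟩
  | succ n ih =>
    refine ⟨differentiable_const c, fun _ => le_rfl, ?_⟩
    have := ih (0 : E →L[ℝ] F)
    rw [fderiv_fun_const]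
    exact this.mono (by simp)

lemma add {n : ℕ} {α R S : ℝ} {f g : E → F} (hf : HolderBdd n α R f) (hg : HolderBdd n α S g) :
    HolderBdd n α (R + S) (fun x => f x + g x) := by
  induction n generalizing F with
  | zero =>
    refine ⟨fun x => (norm_add_le _ _).trans (add_le_add (hf.1 x) (hg.1 x)), fun x y => ?_⟩
    rw [add_sub_add_comm, add_mul]
    exact (norm_add_le _ _).trans (add_le_add (hf.2 x y) (hg.2 x y))
  | succ n ih =>
    refine ⟨hf.1.add hg.1,
      fun x => (norm_add_le _ _).trans (add_le_add (hf.2.1 x) (hg.2.1 x)), ?_⟩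
    have : fderiv ℝ (fun x => f x + g x) = fun x => fderiv ℝ f x + fderiv ℝ g x := by
      ext1 x
      exact fderiv_fun_add (hf.1 x) (hg.1 x)
    rw [this]
    exact ih hf.2.2 hg.2.2

lemma neg {n : ℕ} {α R : ℝ} {f : E → F} (hf : HolderBdd n α R f) :
    HolderBdd n α R (fun x => - f x) := by
  induction n generalizing F with
  | zero =>
    refine ⟨fun x => by simpa using hf.1 x, fun x y => ?_⟩
    rw [neg_sub_neg, norm_sub_rev]
    exact hf.2 x y
  | succ n ih =>
    refine ⟨hf.1.neg, fun x => by simpa using hf.2.1 x, ?_⟩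
    have : fderiv ℝ (fun x => - f x) = fun x => - fderiv ℝ f x := by
      ext1 x
      exact fderiv_fun_neg
    rw [this]
    exact ih hf.2.2

lemma sub {n : ℕ} {α R S : ℝ} {f g : E → F} (hf : HolderBdd n α R f) (hg : HolderBdd n α S g) :
    HolderBdd n α (R + S) (fun x => f x - g x) := by
  simpa [sub_eq_add_neg] using hf.add hg.neg

lemma of_lipschitz {α R : ℝ} (hα : 0 < α) (hα1 : α ≤ 1) {f : E → F} (h : ∀ x, ‖f x‖ ≤ R)
    (hL : ∀ x y, ‖f x - f y‖ ≤ R * ‖x - y‖) : HolderBdd 0 α (2 * R) f := by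
  have hR : 0 ≤ R := (norm_nonneg _).trans (h 0)
  refine ⟨fun x => (h x).trans (by linarith), fun x y => ?_⟩
  rcases le_total ‖x - y‖ 1 with h1 | h1
  · have := Real.rpow_le_rpow_of_exponent_ge_of_imp (norm_nonneg (x - y)) h1 hα1
      (fun _ h0 => absurd h0 one_ne_zero)
    rw [Real.rpow_one] at this
    calc ‖f x - f y‖ ≤ R * ‖x - y‖ := hL x y
      _ ≤ R * ‖x - y‖ ^ α := by gcongr
      _ ≤ 2 * R * ‖x - y‖ ^ α := by gcongr; linarith
  · calc ‖f x - f y‖ ≤ ‖f x‖ + ‖f y‖ := norm_sub_le _ _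
      _ ≤ 2 * R * 1 := by linarith [h x, h y]
      _ ≤ 2 * R * ‖x - y‖ ^ α := by gcongr; exact Real.one_le_rpow h1 hα.le

lemma norm_sub_le_of_fderiv {R : ℝ} {f : E → F} (hf : Differentiable ℝ f)
    (h : ∀ x, ‖fderiv ℝ f x‖ ≤ R) (x y : E) : ‖f x - f y‖ ≤ R * ‖x - y‖ :=
  convex_univ.norm_image_sub_le_of_norm_fderiv_le (fun x _ => hf x) (fun x _ => h x)
    (mem_univ y) (mem_univ x)

lemma of_succ {n : ℕ} {α R : ℝ} (hα : 0 < α) (hα1 : α ≤ 1) {f : E → F}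
    (h : HolderBdd (n + 1) α R f) : HolderBdd n α (2 * R) f := by
  induction n generalizing F with
  | zero => exact of_lipschitz hα hα1 h.2.1 (norm_sub_le_of_fderiv h.1 h.2.2.norm_le)
  | succ n ih => exact ⟨h.1, fun x => (h.2.1 x).trans (by linarith [h.nonneg]), ih h.2.2⟩

lemma order_zero {n : ℕ} {α R : ℝ} (hα : 0 < α) (hα1 : α ≤ 1) {f : E → F}
    (h : HolderBdd n α R f) : HolderBdd 0 α (2 ^ n * R) f := by
  induction n generalizing R with
  | zero => simpa using h
  | succ n ih => exact (ih (h.of_succ hα hα1)).mono (by rw [pow_succ, mul_assoc])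

lemma contDiff {n : ℕ} {α R : ℝ} (hα : 0 < α) {f : E → F}
    (h : HolderBdd n α R f) : ContDiff ℝ n f := by
  induction n generalizing F with
  | zero =>
    refine contDiff_zero.2 (continuous_iff_continuousAt.2 fun x => ?_)
    refine tendsto_iff_norm_sub_tendsto_zero.2
      (squeeze_zero (fun _ => norm_nonneg _) (fun y => h.2 y x) ?_)
    have h1 : Tendsto (fun y => ‖y - x‖) (𝓝 x) (𝓝 0) := by
      simpa using ((tendsto_id (x := 𝓝 x)).sub_const x).norm
    simpa [Real.zero_rpow hα.ne'] using
      (h1.rpow_const (p := α) (Or.inr hα.le)).const_mul R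
  | succ n ih =>
    have := contDiff_succ_iff_fderiv (𝕜 := ℝ) (f := f) (n := n)
    push_cast
    exact this.2 ⟨h.1, by simp, ih h.2.2⟩

lemma norm_bilin_le (B : F →L[ℝ] G →L[ℝ] H) {a : F} {b : G} {S T : ℝ} (ha : ‖a‖ ≤ S)
    (hb : ‖b‖ ≤ T) : ‖B a b‖ ≤ ‖B‖ * S * T := by
  refine (B.le_opNorm₂ a b).trans ?_
  have := (norm_nonneg a).trans ha
  gcongr

lemma bilin (n : ℕ) {α : ℝ} (hα : 0 < α) (hα1 : α ≤ 1) (B : F →L[ℝ] G →L[ℝ] H) (R : ℝ) :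
    ∃ S, ∀ (f : E → F) (g : E → G), HolderBdd n α R f → HolderBdd n α R g →
      HolderBdd n α S (fun x => B (f x) (g x)) := by
  induction n generalizing F G H R with
  | zero =>
    refine ⟨‖B‖ * R * R + ‖B‖ * R * R, fun f g hf hg => ?_⟩
    have hR := hf.nonneg
    refine ⟨fun x => (norm_bilin_le B (hf.1 x) (hg.1 x)).trans
      (le_add_of_nonneg_right (by positivity)), fun x y => ?_⟩
    have : B (f x) (g x) - B (f y) (g y)
        = B (f x - f y) (g x) + B (f y) (g x - g y) := by
      simp
    rw [this]
    refine (norm_add_le _ _).trans ?_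
    have h1 := norm_bilin_le B (hf.2 x y) (hg.1 x)
    have h2 := norm_bilin_le B (hf.1 y) (hg.2 x y)
    nlinarith [h1, h2]
  | succ n ih =>
    obtain ⟨S₁, h₁⟩ := ih (B.precompR E) (2 * R)
    obtain ⟨S₂, h₂⟩ := ih (B.precompL E) (2 * R)
    refine ⟨max (‖B‖ * R * R) (S₁ + S₂), fun f g hf hg => ⟨?_, fun x => ?_, ?_⟩⟩
    · exact fun x => (B.hasFDerivAt_of_bilinear (hf.1 x).hasFDerivAt
        (hg.1 x).hasFDerivAt).differentiableAt
    · exact (norm_bilin_le B (hf.2.1 x) (hg.2.1 x)).trans (le_max_left _ _)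
    · have : fderiv ℝ (fun x => B (f x) (g x)) = fun x =>
          B.precompR E (f x) (fderiv ℝ g x) + B.precompL E (fderiv ℝ f x) (g x) := by
        ext1 x
        exact B.fderiv_of_bilinear (hf.1 x) (hg.1 x)
      rw [this]
      have hR := hf.nonneg
      exact ((h₁ _ _ (hf.of_succ hα hα1) (hg.2.2.mono (by linarith))).add
        (h₂ _ _ (hf.2.2.mono (by linarith)) (hg.of_succ hα hα1))).mono (le_max_right _ _)

lemma comp_lipschitz {α R L : ℝ} (hα : 0 < α) {f : F → G} {g : E → F}
    (hf : HolderBdd 0 α R f) (hL : 0 ≤ L) (hg : ∀ x y, ‖g x - g y‖ ≤ L * ‖x - y‖) :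
    HolderBdd 0 α (max R (R * L ^ α)) (fun x => f (g x)) := by
  have hR := hf.nonneg
  refine ⟨fun x => (hf.1 _).trans (le_max_left _ _), fun x y => ?_⟩
  calc ‖f (g x) - f (g y)‖ ≤ R * ‖g x - g y‖ ^ α := hf.2 _ _
    _ ≤ R * (L * ‖x - y‖) ^ α := by gcongr; exact hg x y
    _ = R * L ^ α * ‖x - y‖ ^ α := by
      rw [Real.mul_rpow hL (norm_nonneg _)]; ring
    _ ≤ _ := by gcongr; exact le_max_right _ _

lemma fderiv_comp_eq_compL {f : F → G} {g : E → F} (hf : Differentiable ℝ f)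
    (hg : Differentiable ℝ g) : fderiv ℝ (fun x => f (g x)) = fun x =>
      ContinuousLinearMap.compL ℝ E F G (fderiv ℝ f (g x)) (fderiv ℝ g x) :=
  funext fun x => fderiv_fun_comp x (hf _) (hg x)

lemma comp (n : ℕ) {α : ℝ} (hα : 0 < α) (hα1 : α ≤ 1) (R : ℝ) :
    ∃ S, ∀ (f : F → G) (g : E → F), HolderBdd (n + 1) α R f → Differentiable ℝ g →
      HolderBdd n α R (fderiv ℝ g) → HolderBdd (n + 1) α S (fun x => f (g x)) := by
  induction n generalizing G R with
  | zero =>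
    obtain ⟨S, hS⟩ := bilin (E := E) 0 hα hα1 (ContinuousLinearMap.compL ℝ E F G)
      (max R (R * R ^ α))
    refine ⟨max R S, fun f g hf hg hg' => ⟨hf.1.comp hg,
      fun x => (hf.2.1 _).trans (le_max_left _ _), ?_⟩⟩
    rw [fderiv_comp_eq_compL hf.1 hg]
    exact (hS _ _ (hf.2.2.comp_lipschitz hα hf.nonneg (norm_sub_le_of_fderiv hg hg'.norm_le))
      (hg'.mono (le_max_left _ _))).mono (le_max_right _ _)
  | succ n ih =>
    obtain ⟨T, hT⟩ := ih (G := F →L[ℝ] G) (2 * R)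
    obtain ⟨S, hS⟩ := bilin (E := E) (n + 1) hα hα1 (ContinuousLinearMap.compL ℝ E F G)
      (max R T)
    refine ⟨max R S, fun f g hf hg hg' => ⟨hf.1.comp hg,
      fun x => (hf.2.1 _).trans (le_max_left _ _), ?_⟩⟩
    rw [fderiv_comp_eq_compL hf.1 hg]
    have hR := hf.nonneg
    have := hT _ _ (hf.2.2.mono (by linarith)) hg (hg'.of_succ hα hα1)
    exact (hS _ _ (this.mono (le_max_right _ _)) (hg'.mono (le_max_left _ _))).mono
      (le_max_right _ _)

lemma inverse {A : Type u} [NormedRing A] [NormedAlgebra ℝ A] [CompleteSpace A] (n : ℕ) {α : ℝ}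
    (hα : 0 < α) (hα1 : α ≤ 1) (R : ℝ) :
    ∃ S, ∀ (a b : E → A), (∀ x, a x * b x = 1) → (∀ x, b x * a x = 1) → (∀ x, ‖b x‖ ≤ R) →
      HolderBdd n α R a → HolderBdd n α S b := by
  induction n generalizing R with
  | zero =>
    refine ⟨max R (R * R * R), fun a b hab hba hb ha => ?_⟩
    have hR := ha.nonneg
    refine ⟨fun x => (hb x).trans (le_max_left _ _), fun x y => ?_⟩
    have h : b x - b y = b x * (a y - a x) * b y := by
      rw [mul_sub, sub_mul, mul_assoc, hab, hba]; simp
    calc ‖b x - b y‖ ≤ ‖b x‖ * ‖a y - a x‖ * ‖b y‖ := by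
          rw [h]; exact (norm_mul_le _ _).trans (by gcongr; exact norm_mul_le _ _)
      _ ≤ R * (R * ‖x - y‖ ^ α) * R := by
          gcongr
          · exact hb x
          · rw [norm_sub_rev]; exact ha.2 x y
          · exact hb y
      _ = R * R * R * ‖x - y‖ ^ α := by ring
      _ ≤ _ := by gcongr; exact le_max_right _ _
  | succ n ih =>
    obtain ⟨S, hS⟩ := ih (2 * R)
    obtain ⟨T, hT⟩ := bilin (E := E) n hα hα1 (ContinuousLinearMap.mulLeftRight ℝ A) S
    obtain ⟨U, hU⟩ := bilin (E := E) n hα hα1 (ContinuousLinearMap.compL ℝ E A A) (max R T)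
    refine ⟨max R U, fun a b hab hba hb ha => ?_⟩
    have hR := ha.nonneg
    have hd : ∀ x, HasFDerivAt b (-(ContinuousLinearMap.compL ℝ E A A
        (ContinuousLinearMap.mulLeftRight ℝ A (b x) (b x)) (fderiv ℝ a x))) x := by
      intro x
      let u : E → Aˣ := fun x => ⟨a x, b x, hab x, hba x⟩
      have hb' : b = fun x => Ring.inverse (a x) := by
        ext1 x
        exact (Ring.inverse_unit (u x)).symm
      have h1 := (hasFDerivAt_ringInverse (𝕜 := ℝ) (u x)).comp x (ha.1 x).hasFDerivAt
      have h2 : Ring.inverse ∘ a = b := hb'.symm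
      rw [h2] at h1
      exact h1
    refine ⟨fun x => (hd x).differentiableAt, fun x => (hb x).trans (le_max_left _ _), ?_⟩
    rw [show fderiv ℝ b = fun x => -(ContinuousLinearMap.compL ℝ E A A
        (ContinuousLinearMap.mulLeftRight ℝ A (b x) (b x)) (fderiv ℝ a x)) from
        funext fun x => (hd x).fderiv]
    have hb' := hS a b hab hba (fun x => (hb x).trans (by linarith)) (ha.of_succ hα hα1)
    exact (hU _ _ ((hT _ _ hb' hb').mono (le_max_right _ _))
      (ha.2.2.mono (le_max_left _ _))).neg.mono (le_max_right _ _)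

/-- A Landau-type inequality: a function that is small on a ball and has a Hölder continuous
derivative has a small derivative at the centre. -/
lemma norm_fderiv_le_of_small {α C η t : ℝ} {f : E → F} (hα : 0 < α) (hf : Differentiable ℝ f)
    (hC : HolderBdd 0 α C (fderiv ℝ f)) (ht : 0 < t) (x : E)
    (hη : ∀ y, ‖y - x‖ ≤ t → ‖f y‖ ≤ η) : ‖fderiv ℝ f x‖ ≤ C * t ^ α + 2 * η / t := by
  have hC0 := hC.nonneg
  have hη0 : 0 ≤ η := (norm_nonneg _).trans (hη x (by simpa using ht.le))
  refine ContinuousLinearMap.opNorm_le_of_unit_norm (by positivity) fun v hv => ?_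
  have hxv : ‖x + t • v - x‖ = t := by simp [norm_smul, hv, abs_of_pos ht]
  have h1 : ‖f (x + t • v) - f x - fderiv ℝ f x (x + t • v - x)‖ ≤
      C * t ^ α * ‖x + t • v - x‖ := by
    refine (convex_closedBall x t).norm_image_sub_le_of_norm_fderiv_le' (𝕜 := ℝ)
      (fun y _ => hf y) (fun y hy => ?_) (Metric.mem_closedBall_self ht.le) ?_
    · rw [mem_closedBall_iff_norm] at hy
      exact (hC.2 y x).trans (by gcongr)
    · rw [mem_closedBall_iff_norm, hxv]
  have h2 : t * ‖fderiv ℝ f x v‖ ≤ C * t ^ α * t + 2 * η := by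
    have h3 : fderiv ℝ f x (x + t • v - x) = t • fderiv ℝ f x v := by simp
    rw [h3, hxv] at h1
    have h4 : ‖t • fderiv ℝ f x v‖ = t * ‖fderiv ℝ f x v‖ := by
      rw [norm_smul, Real.norm_of_nonneg ht.le]
    have h5 := norm_sub_norm_le (t • fderiv ℝ f x v) (f (x + t • v) - f x)
    rw [norm_sub_rev (t • fderiv ℝ f x v)] at h5
    have h6 := norm_sub_le (f (x + t • v)) (f x)
    have h7 := hη (x + t • v) hxv.le
    have h8 := hη x (by simpa using ht.le)
    linarith
  rw [show C * t ^ α + 2 * η / t = (C * t ^ α * t + 2 * η) / t by field_simp,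
    le_div_iff₀ ht]
  linarith

lemma exists_pos_mul_rpow_le {γ : ℝ} (hγ : 0 < γ) (C : ℝ) {ε : ℝ} (hε : 0 < ε) :
    ∃ t, 0 < t ∧ C * t ^ γ ≤ ε := by
  have h : Tendsto (fun t : ℝ => C * t ^ γ) (𝓝[>] 0) (𝓝 0) := by
    have := (tendsto_id.mono_left (nhdsWithin_le_nhds (a := (0 : ℝ)) (s := Ioi 0))).rpow_const
      (p := γ) (Or.inr hγ.le)
    simpa [Real.zero_rpow hγ.ne'] using this.const_mul C
  obtain ⟨t, h1, h2⟩ := ((h.eventually (eventually_le_nhds hε)).and self_mem_nhdsWithin).exists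
  exact ⟨t, h2, h1⟩

/-- Interpolation: a uniformly small family that is bounded in `C^{n,α'}` is small in `C^{n,α}`
for `α < α'`. -/
lemma small_of_norm_le (n : ℕ) {α α' : ℝ} (hα : 0 < α) (hαα' : α < α') (hα' : α' ≤ 1) (R : ℝ)
    {ε : ℝ} (hε : 0 < ε) :
    ∃ η > 0, ∀ f : E → F, HolderBdd n α' R f → (∀ x, ‖f x‖ ≤ η) → HolderBdd n α ε f := by
  induction n generalizing F R ε with
  | zero =>
    obtain ⟨t, ht, hRt⟩ := exists_pos_mul_rpow_le (sub_pos.2 hαα') R hε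
    refine ⟨min ε (ε * t ^ α / 2), by positivity, fun f hf hη => ?_⟩
    refine ⟨fun x => (hη x).trans (min_le_left _ _), fun x y => ?_⟩
    have hR := hf.nonneg
    rcases le_or_gt ‖x - y‖ t with h | h
    · calc ‖f x - f y‖ ≤ R * ‖x - y‖ ^ α' := hf.2 x y
        _ = R * ‖x - y‖ ^ (α' - α) * ‖x - y‖ ^ α := by
          rw [mul_assoc, ← Real.rpow_add_of_nonneg (norm_nonneg _) (by linarith) hα.le]
          simp
        _ ≤ R * t ^ (α' - α) * ‖x - y‖ ^ α := by
          have : 0 ≤ α' - α := by linarith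
          gcongr
        _ ≤ ε * ‖x - y‖ ^ α := by gcongr
    · calc ‖f x - f y‖ ≤ ‖f x‖ + ‖f y‖ := norm_sub_le _ _
        _ ≤ ε * t ^ α := by
          linarith [(hη x).trans (min_le_right _ _), (hη y).trans (min_le_right _ _)]
        _ ≤ ε * ‖x - y‖ ^ α := by gcongr
  | succ n ih =>
    obtain ⟨η₁, hη₁, h₁⟩ := ih (F := E →L[ℝ] F) R hε
    have hα0 : 0 < α' := hα.trans hαα'
    obtain ⟨t, ht, hRt⟩ := exists_pos_mul_rpow_le hα0 (2 ^ n * R) (half_pos hη₁)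
    refine ⟨min ε (t * η₁ / 4), by positivity, fun f hf hη => ?_⟩
    refine ⟨hf.1, fun x => (hη x).trans (min_le_left _ _), h₁ _ hf.2.2 fun x => ?_⟩
    refine (norm_fderiv_le_of_small hα0 hf.1 (hf.2.2.order_zero hα0 hα') ht x
      (fun y _ => (hη y).trans (min_le_right _ _))).trans ?_
    have : 2 * (t * η₁ / 4) / t = η₁ / 2 := by field_simp; ring
    linarith

lemma tendsto_fderiv [ProperSpace E] {n : ℕ} {α R : ℝ} (hα : 0 < α) (hα1 : α ≤ 1) {f : E → F}
    (hf : HolderBdd (n + 1) α R f) (h0 : Tendsto f (cocompact E) (𝓝 0)) :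
    Tendsto (fderiv ℝ f) (cocompact E) (𝓝 0) := by
  rw [← Metric.cobounded_eq_cocompact] at h0 ⊢
  rw [Metric.tendsto_nhds]
  intro ε hε
  obtain ⟨t, ht, hRt⟩ := exists_pos_mul_rpow_le hα (2 ^ n * R) (half_pos hε)
  have h1 := Metric.tendsto_nhds.1 h0 (t * ε / 8) (by positivity)
  obtain ⟨r, -, hr⟩ := (Metric.hasBasis_cobounded_compl_closedBall (0 : E)).eventually_iff.1 h1
  refine (Metric.hasBasis_cobounded_compl_closedBall (0 : E)).eventually_iff.2
    ⟨r + t, trivial, fun x hx => ?_⟩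
  rw [dist_zero_right]
  have h2 := norm_fderiv_le_of_small hα hf.1 (hf.2.2.order_zero hα hα1) ht x
    (η := t * ε / 8) (fun y hy => ?_)
  · have : 2 * (t * ε / 8) / t = ε / 4 := by field_simp; ring
    linarith
  · have h3 : y ∈ (Metric.closedBall (0 : E) r)ᶜ := by
      simp only [mem_compl_iff, mem_closedBall_zero_iff, not_le] at hx ⊢
      have := norm_sub_norm_le x y
      rw [norm_sub_rev] at this
      linarith
    simpa using (hr h3).le

lemma tendsto_iteratedFDeriv [ProperSpace E] {n : ℕ} {α R : ℝ} (hα : 0 < α) (hα1 : α ≤ 1)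
    {f : E → F} (hf : HolderBdd n α R f) (h0 : Tendsto f (cocompact E) (𝓝 0)) (l : ℕ)
    (hl : l ≤ n) : Tendsto (fun x => ‖iteratedFDeriv ℝ l f x‖) (cocompact E) (𝓝 0) := by
  induction l generalizing n F with
  | zero => simpa using h0.norm
  | succ l ih =>
    obtain ⟨m, rfl⟩ : ∃ m, n = m + 1 := ⟨n - 1, by omega⟩
    simp_rw [← norm_iteratedFDeriv_fderiv]
    exact ih hf.2.2 (hf.tendsto_fderiv hα hα1 h0) (by omega)

lemma norm_iteratedFDeriv_zero_sub (f : E → F) (x y : E) :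
    ‖iteratedFDeriv ℝ 0 f x - iteratedFDeriv ℝ 0 f y‖ = ‖f x - f y‖ := by
  rw [iteratedFDeriv_zero_eq_comp, comp_apply, comp_apply, ← map_sub, LinearIsometryEquiv.norm_map]

lemma norm_iteratedFDeriv_succ_sub (f : E → F) (n : ℕ) (x y : E) :
    ‖iteratedFDeriv ℝ (n + 1) f x - iteratedFDeriv ℝ (n + 1) f y‖ =
      ‖iteratedFDeriv ℝ n (fderiv ℝ f) x - iteratedFDeriv ℝ n (fderiv ℝ f) y‖ := by
  rw [iteratedFDeriv_succ_eq_comp_right, iteratedFDeriv_succ_eq_comp_right, comp_apply, comp_apply,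
    ← dist_eq_norm, ← dist_eq_norm]
  exact LinearIsometryEquiv.dist_map _ _ _

lemma iff_iteratedFDeriv {n : ℕ} {α R : ℝ} (hα : 0 < α) {f : E → F} :
    HolderBdd n α R f ↔ ContDiff ℝ n f ∧ (∀ l ≤ n, ∀ x, ‖iteratedFDeriv ℝ l f x‖ ≤ R) ∧
      ∀ x y, ‖iteratedFDeriv ℝ n f x - iteratedFDeriv ℝ n f y‖ ≤ R * ‖x - y‖ ^ α := by
  refine ⟨fun h => ⟨h.contDiff hα, ?_⟩, fun h => ?_⟩
  · induction n generalizing F with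
    | zero =>
      simp_rw [norm_iteratedFDeriv_zero_sub]
      exact ⟨fun l hl x => by obtain rfl := Nat.le_zero.1 hl; simpa using h.1 x, h.2⟩
    | succ n ih =>
      simp_rw [norm_iteratedFDeriv_succ_sub]
      refine ⟨fun l hl x => ?_, (ih h.2.2).2⟩
      cases l with
      | zero => simpa using h.2.1 x
      | succ l =>
        rw [← norm_iteratedFDeriv_fderiv]
        exact (ih h.2.2).1 l (by omega) x
  · obtain ⟨hd, hb, hh⟩ := h
    induction n generalizing F with
    | zero =>
      simp_rw [norm_iteratedFDeriv_zero_sub] at hh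
      exact ⟨fun x => by simpa using hb 0 le_rfl x, hh⟩
    | succ n ih =>
      simp_rw [norm_iteratedFDeriv_succ_sub] at hh
      push_cast at hd
      have hd' := contDiff_succ_iff_fderiv.1 hd
      refine ⟨hd'.1, fun x => by simpa using hb 0 (Nat.zero_le _) x, ih hd'.2.2 ?_ hh⟩
      intro l hl x
      rw [norm_iteratedFDeriv_fderiv]
      exact hb (l + 1) (by omega) x

lemma iff_eHnorm_le {n : ℕ} {α R : ℝ} (hα : 0 < α) (hR : 0 ≤ R) {f : E → F} :
    HolderBdd n α R f ↔ ContDiff ℝ n f ∧ eHnorm n α f ≤ ENNReal.ofReal R := by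
  rw [iff_iteratedFDeriv hα, eHnorm, max_le_iff, eCnb, eHsemi]
  simp only [iSup_le_iff]
  refine and_congr_right fun _ => and_congr ⟨fun h l x => ?_, fun h l hl x => ?_⟩
    (forall₂_congr fun x y => ?_)
  · rw [← enorm_eq_nnnorm, ← ofReal_norm]
    exact ENNReal.ofReal_le_ofReal (h l (by omega) x)
  · have := h ⟨l, by omega⟩ x
    rw [← enorm_eq_nnnorm, ← ofReal_norm] at this
    exact (ENNReal.ofReal_le_ofReal_iff hR).1 this
  · rcases eq_or_ne x y with rfl | hxy
    · simp only [sub_self, norm_zero, ne_eq, not_true_eq_false, false_imp_iff, iff_true]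
      positivity
    · have hpos : 0 < ‖x - y‖ := norm_sub_pos_iff.2 hxy
      have hp := Real.rpow_pos_of_pos hpos α
      rw [edist_dist, dist_eq_norm, ENNReal.ofReal_rpow_of_pos hpos, ← enorm_eq_nnnorm,
        ← ofReal_norm, ENNReal.div_le_iff (by simpa using hp) ENNReal.ofReal_ne_top,
        ← ENNReal.ofReal_mul hR, ENNReal.ofReal_le_ofReal_iff (by positivity)]
      exact ⟨fun h _ => h, fun h => h hxy⟩

lemma hnorm_le {n : ℕ} {α R : ℝ} (hα : 0 < α) {f : E → F} (h : HolderBdd n α R f) :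
    hnorm n α f ≤ R :=
  ENNReal.toReal_le_of_le_ofReal h.nonneg ((iff_eHnorm_le hα h.nonneg).1 h).2

lemma memCb {n : ℕ} {α R : ℝ} (hα : 0 < α) {f : E → F} (h : HolderBdd n α R f) :
    MemCb n α f := by
  have := (iff_eHnorm_le hα h.nonneg).1 h
  exact ⟨by exact_mod_cast this.1, this.2.trans_lt ENNReal.ofReal_lt_top⟩

lemma of_memCb {n : ℕ} {α : ℝ} (hα : 0 < α) {f : E → F} (h : MemCb n α f) :
    HolderBdd n α (hnorm n α f) f :=
  (iff_eHnorm_le hα ENNReal.toReal_nonneg).2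
    ⟨by exact_mod_cast h.1, (ENNReal.ofReal_toReal h.2.ne).ge⟩

end HolderBdd

lemma memC0_iff [ProperSpace E] {n : ℕ} {α : ℝ} (hα : 0 < α) (hα1 : α ≤ 1) {f : E → F} :
    MemC0 n α f ↔ (∃ R, HolderBdd n α R f) ∧ Tendsto f (cocompact E) (𝓝 0) := by
  refine ⟨fun h => ⟨⟨_, .of_memCb hα h.1⟩, ?_⟩, fun ⟨⟨R, hR⟩, h0⟩ =>
    ⟨hR.memCb hα, hR.tendsto_iteratedFDeriv hα hα1 h0⟩⟩
  have := h.2 0 (Nat.zero_le n)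
  simp only [norm_iteratedFDeriv_zero] at this
  exact tendsto_zero_iff_norm_tendsto_zero.2 this

end HolderBounds

section Diffeomorphisms

universe u

variable {E : Type u} [NormedAddCommGroup E] [NormedSpace ℝ E]

lemma fderiv_sub_id {Φ : E → E} {x : E} (h : DifferentiableAt ℝ Φ x) :
    fderiv ℝ (fun x => Φ x - x) x = fderiv ℝ Φ x - 1 := by
  have := fderiv_fun_sub h (differentiableAt_id (𝕜 := ℝ) (E := E))
  rw [fderiv_id] at this
  exact this

lemma injective_of_lower_bound {A : E →L[ℝ] E} {K : ℝ} (hK : ∀ v, ‖v‖ ≤ K * ‖A v‖) :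
    Injective A := by
  refine (injective_iff_map_eq_zero A).2 fun v hv => ?_
  simpa [hv] using hK v

namespace HolderBdd

variable {n : ℕ} {α R : ℝ} {Φ : E → E}

lemma contDiff_of_sub_id (hα : 0 < α) (h : HolderBdd n α R (fun x => Φ x - x)) :
    ContDiff ℝ n Φ := by
  simpa using (h.contDiff hα).add contDiff_id

lemma fderiv_of_sub_id (h : HolderBdd (n + 1) α R (fun x => Φ x - x)) :
    HolderBdd n α (R + 1) (fderiv ℝ Φ) := by
  have hΦ : Differentiable ℝ Φ := by simpa using h.1.add differentiable_id
  have h1 : fderiv ℝ Φ = fun x => fderiv ℝ (fun x => Φ x - x) x + 1 := by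
    ext1 x
    rw [fderiv_sub_id (hΦ x)]
    exact (sub_add_cancel _ _).symm
  rw [h1]
  exact h.2.2.add ((const n α (1 : E →L[ℝ] E)).mono ContinuousLinearMap.norm_id_le)

lemma comp_sub_id (n : ℕ) (hα : 0 < α) (hα1 : α ≤ 1) (R : ℝ) :
    ∃ S, ∀ Φ Ψ : E → E, HolderBdd (n + 1) α R (fun x => Φ x - x) →
      HolderBdd (n + 1) α R (fun x => Ψ x - x) →
      HolderBdd (n + 1) α S (fun x => Φ (Ψ x) - x) := by
  obtain ⟨S, hS⟩ := comp (E := E) (F := E) (G := E) n hα hα1 (R + 1)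
  refine ⟨S + R, fun Φ Ψ hΦ hΨ => ?_⟩
  have hd : Differentiable ℝ Ψ := by simpa using hΨ.1.add differentiable_id
  simpa using (hS _ _ (hΦ.mono (by linarith)) hd hΨ.fderiv_of_sub_id).add hΨ

end HolderBdd

variable [FiniteDimensional ℝ E]

lemma tendsto_cocompact_of_sub_id {Φ : E → E}
    (h0 : Tendsto (fun x => Φ x - x) (cocompact E) (𝓝 0)) :
    Tendsto Φ (cocompact E) (cocompact E) := by
  have : ProperSpace E := FiniteDimensional.proper_real E
  rw [← Metric.cobounded_eq_cocompact] at h0 ⊢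
  rw [← tendsto_norm_atTop_iff_cobounded]
  have h1 : ∀ᶠ x in Bornology.cobounded E, ‖x‖ - 1 ≤ ‖Φ x‖ := by
    filter_upwards [Metric.tendsto_nhds.1 h0 1 one_pos] with x hx
    rw [dist_zero_right, norm_sub_rev] at hx
    linarith [norm_sub_norm_le x (Φ x)]
  exact tendsto_atTop_mono' _ h1 (tendsto_atTop_add_const_right _ _ tendsto_norm_cobounded_atTop)

lemma exists_norm_le_of_tendsto_cocompact {X F : Type*} [TopologicalSpace X]
    [NormedAddCommGroup F] {g : X → F} {c : F} (hg : Continuous g)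
    (h : Tendsto g (cocompact X) (𝓝 c)) : ∃ K, ∀ x, ‖g x‖ ≤ K := by
  have h1 : ∀ᶠ x in cocompact X, ‖g x‖ < ‖c‖ + 1 :=
    h.norm.eventually (gt_mem_nhds (lt_add_one _))
  obtain ⟨t, ht, hts⟩ := mem_cocompact.1 h1
  obtain ⟨K, hK⟩ := ht.exists_bound_of_continuousOn hg.continuousOn
  refine ⟨max K (‖c‖ + 1), fun x => ?_⟩
  by_cases hx : x ∈ t
  · exact (hK x hx).trans (le_max_left _ _)
  · exact (hts hx).le.trans (le_max_right _ _)

lemma exists_fderiv_lower_bound {Φ : E → E} (hΦ : ContDiff ℝ 1 Φ)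
    (hdet : ∀ x, (fderiv ℝ Φ x).det ≠ 0)
    (h1 : Tendsto (fderiv ℝ (fun x => Φ x - x)) (cocompact E) (𝓝 0)) :
    ∃ K, ∀ x v, ‖v‖ ≤ K * ‖fderiv ℝ Φ x v‖ := by
  have : CompleteSpace E := FiniteDimensional.complete ℝ E
  have hu : ∀ x, ∃ u : (E →L[ℝ] E)ˣ, (u : E →L[ℝ] E) = fderiv ℝ Φ x := fun x =>
    ⟨ContinuousLinearEquiv.toUnit ((fderiv ℝ Φ x).toContinuousLinearEquivOfDetNeZero (hdet x)),
      ContinuousLinearMap.coe_toContinuousLinearEquivOfDetNeZero _ _⟩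
  choose u hu using hu
  have hc : Continuous fun x => Ring.inverse (fderiv ℝ Φ x) := by
    refine continuous_iff_continuousAt.2 fun x => ?_
    have h := NormedRing.inverse_continuousAt (u x)
    rw [hu] at h
    exact h.comp (f := fderiv ℝ Φ) (hΦ.continuous_fderiv one_ne_zero).continuousAt
  have hlim : Tendsto (fun x => Ring.inverse (fderiv ℝ Φ x)) (cocompact E)
      (𝓝 (Ring.inverse (1 : E →L[ℝ] E))) := by
    have h2 : Tendsto (fderiv ℝ Φ) (cocompact E) (𝓝 1) := by
      have h3 := h1.add_const (1 : E →L[ℝ] E)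
      rw [zero_add] at h3
      refine h3.congr fun x => ?_
      rw [fderiv_sub_id (hΦ.differentiable one_ne_zero x)]
      exact sub_add_cancel _ _
    exact (NormedRing.inverse_continuousAt (1 : (E →L[ℝ] E)ˣ)).tendsto.comp h2
  obtain ⟨K, hK⟩ := exists_norm_le_of_tendsto_cocompact hc hlim
  refine ⟨K, fun x v => ?_⟩
  have h4 : Ring.inverse (fderiv ℝ Φ x) (fderiv ℝ Φ x v) = v := by
    rw [← hu, Ring.inverse_unit, ← mul_apply_eq_comp, Units.inv_mul]
    rfl
  calc ‖v‖ = ‖Ring.inverse (fderiv ℝ Φ x) (fderiv ℝ Φ x v)‖ := by rw [h4]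
    _ ≤ _ := ContinuousLinearMap.le_of_opNorm_le _ (hK x) _

lemma exists_strictFDeriv_equiv {Φ : E → E} (hΦ : ContDiff ℝ 1 Φ)
    (hinj : ∀ x, Injective (fderiv ℝ Φ x)) (x : E) :
    ∃ e : E ≃L[ℝ] E, (e : E →L[ℝ] E) = fderiv ℝ Φ x ∧ HasStrictFDerivAt Φ (e : E →L[ℝ] E) x := by
  have h : ((LinearEquiv.ofInjectiveEndo (fderiv ℝ Φ x : E →ₗ[ℝ] E)
      (hinj x)).toContinuousLinearEquiv : E →L[ℝ] E) = fderiv ℝ Φ x := by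
    ext v
    rfl
  refine ⟨_, h, ?_⟩
  rw [h]
  exact hΦ.contDiffAt.hasStrictFDerivAt one_ne_zero

/-- A proper local diffeomorphism asymptotic to the identity is bijective. -/
lemma bijective_of_asymptotic_id {Φ : E → E} (hΦ : ContDiff ℝ 1 Φ)
    (hinj : ∀ x, Injective (fderiv ℝ Φ x))
    (h0 : Tendsto (fun x => Φ x - x) (cocompact E) (𝓝 0))
    (h1 : Tendsto (fderiv ℝ (fun x => Φ x - x)) (cocompact E) (𝓝 0)) : Bijective Φ := by
  have : ProperSpace E := FiniteDimensional.proper_real E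
  choose e _ he using exists_strictFDeriv_equiv hΦ hinj
  have hopen : IsOpenMap Φ := isOpenMap_of_hasStrictFDerivAt_equiv he
  have hclosed : IsClosedMap Φ := (isProperMap_iff_tendsto_cocompact.2
    ⟨hΦ.continuous, tendsto_cocompact_of_sub_id h0⟩).isClosedMap
  have hsurj : Surjective Φ := by
    rw [← range_eq_univ]
    exact (isClopen_iff.1 ⟨hclosed.isClosed_range, hopen.isOpen_range⟩).resolve_left
      (range_nonempty Φ).ne_empty
  refine ⟨?_, hsurj⟩
  rcases subsingleton_or_nontrivial E with hE | hE
  · exact injective_of_subsingleton Φ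
  let S : Set E := {y | ∃ a b, a ≠ b ∧ Φ a = y ∧ Φ b = y}
  have hSo : IsOpen S := by
    rw [isOpen_iff_mem_nhds]
    rintro y ⟨a, b, hab, rfl, hb⟩
    obtain ⟨U, V, hU, hV, haU, hbV, hUV⟩ := t2_separation hab
    filter_upwards [(hopen U hU).mem_nhds ⟨a, haU, rfl⟩,
      (hopen V hV).mem_nhds ⟨b, hbV, hb⟩]
    rintro z ⟨a', ha', rfl⟩ ⟨b', hb', hz⟩
    exact ⟨a', b', fun h => hUV.le_bot ⟨ha', h ▸ hb'⟩, rfl, hz⟩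
  have hSc : IsClosed S := by
    rw [← isOpen_compl_iff, isOpen_iff_mem_nhds]
    intro y hy
    obtain ⟨a, rfl⟩ := hsurj y
    let P := (he a).toOpenPartialHomeomorph Φ
    have hV : (Φ '' P.sourceᶜ)ᶜ ∈ 𝓝 (Φ a) := by
      refine (hclosed _ P.open_source.isClosed_compl).isOpen_compl.mem_nhds ?_
      rintro ⟨b, hb, hba⟩
      refine hy ⟨a, b, ?_, rfl, hba⟩
      rintro rfl
      exact hb (he a).mem_toOpenPartialHomeomorph_source
    filter_upwards [hV]
    rintro z hz ⟨b, c, hbc, rfl, hc⟩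
    have hb' : b ∈ P.source := by_contra fun h => hz ⟨b, h, rfl⟩
    have hc' : c ∈ P.source := by_contra fun h => hz ⟨c, h, hc⟩
    exact hbc (P.injOn hb' hc' hc.symm)
  have hSu : S ≠ univ := by
    obtain ⟨M, hM⟩ := exists_norm_le_of_tendsto_cocompact
      (hΦ.continuous.sub continuous_id) h0
    rw [← Metric.cobounded_eq_cocompact] at h1
    obtain ⟨r, -, hr⟩ := (Metric.hasBasis_cobounded_compl_closedBall (0 : E)).eventually_iff.1
      (Metric.tendsto_nhds.1 h1 (1 / 2) (by norm_num))
    obtain ⟨y, hy⟩ := NormedSpace.exists_lt_norm ℝ E (r + M)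
    intro hS
    obtain ⟨a, b, hab, ha, hb⟩ : y ∈ S := hS ▸ mem_univ y
    have hmem : ∀ x, Φ x = y → x ∈ Metric.closedBall y M := fun x hx => by
      rw [mem_closedBall_iff_norm, norm_sub_rev, ← hx]
      exact hM x
    have hd : Differentiable ℝ (fun x => Φ x - x) :=
      (hΦ.differentiable one_ne_zero).sub differentiable_id
    have hlip := (convex_closedBall y M).norm_image_sub_le_of_norm_fderiv_le (𝕜 := ℝ)
      (f := fun x => Φ x - x) (C := 1 / 2)
      (fun x _ => hd x) (fun x hx => ?_) (hmem a ha) (hmem b hb)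
    · have h2 : Φ b - b - (Φ a - a) = -(b - a) := by rw [ha, hb]; abel
      simp only [h2, norm_neg] at hlip
      have h3 : 0 < ‖b - a‖ := norm_sub_pos_iff.2 hab.symm
      linarith
    · have h4 : x ∈ (Metric.closedBall (0 : E) r)ᶜ := by
        simp only [mem_compl_iff, mem_closedBall_zero_iff, not_le]
        rw [mem_closedBall_iff_norm, norm_sub_rev] at hx
        linarith [norm_sub_norm_le y x]
      simpa using (hr h4).le
  have hS0 : S = ∅ := (isClopen_iff.1 ⟨hSc, hSo⟩).resolve_right hSu
  intro a b hab
  by_contra hne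
  have : Φ a ∈ S := ⟨a, b, hne, rfl, hab.symm⟩
  simp [hS0] at this

lemma fderiv_inverse_mul_eq_one {Φ Ξ : E → E} (hl : LeftInverse Ξ Φ) (hr : RightInverse Ξ Φ)
    (hΦ : ContDiff ℝ 1 Φ) (hinj : ∀ x, Injective (fderiv ℝ Φ x)) :
    Differentiable ℝ Ξ ∧ (∀ y, fderiv ℝ Φ (Ξ y) * fderiv ℝ Ξ y = 1) ∧
      ∀ y, fderiv ℝ Ξ y * fderiv ℝ Φ (Ξ y) = 1 := by
  have : CompleteSpace E := FiniteDimensional.complete ℝ E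
  have key : ∀ y, ∃ e : E ≃L[ℝ] E, (e : E →L[ℝ] E) = fderiv ℝ Φ (Ξ y) ∧
      HasFDerivAt Ξ (e.symm : E →L[ℝ] E) y := by
    intro y
    obtain ⟨e, he, hs⟩ := exists_strictFDeriv_equiv hΦ hinj (Ξ y)
    have := hs.to_local_left_inverse (g := Ξ) (Eventually.of_forall hl)
    rw [hr y] at this
    exact ⟨e, he, this.hasFDerivAt⟩
  refine ⟨fun y => ?_, fun y => ?_, fun y => ?_⟩ <;> obtain ⟨e, he, hs⟩ := key y
  · exact hs.differentiableAt
  · rw [hs.fderiv, ← he]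
    ext v
    simp
  · rw [hs.fderiv, ← he]
    ext v
    simp

namespace HolderBdd

variable {α : ℝ}

lemma fderiv_inverse_bdd (n : ℕ) (hα : 0 < α) (hα1 : α ≤ 1) (R K : ℝ) :
    ∃ S, ∀ Φ Ξ : E → E, LeftInverse Ξ Φ → RightInverse Ξ Φ →
      HolderBdd (n + 1) α R (fun x => Φ x - x) → (∀ x v, ‖v‖ ≤ K * ‖fderiv ℝ Φ x v‖) →
      HolderBdd n α S (fderiv ℝ Ξ) := by
  have : CompleteSpace E := FiniteDimensional.complete ℝ E
  have bound : ∀ Φ Ξ : E → E, (∀ y, fderiv ℝ Φ (Ξ y) * fderiv ℝ Ξ y = 1) →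
      (∀ x v, ‖v‖ ≤ K * ‖fderiv ℝ Φ x v‖) → ∀ y, ‖fderiv ℝ Ξ y‖ ≤ max K 0 := by
    intro Φ Ξ h hK y
    refine ContinuousLinearMap.opNorm_le_bound _ (le_max_right _ _) fun v => ?_
    have h1 := hK (Ξ y) (fderiv ℝ Ξ y v)
    rw [← mul_apply_eq_comp, h] at h1
    exact h1.trans (mul_le_mul_of_nonneg_right (le_max_left _ _) (norm_nonneg _))
  induction n generalizing R with
  | zero =>
    obtain ⟨S, hS⟩ := inverse (E := E) (A := E →L[ℝ] E) 0 hα hα1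
      (max (max K 0) (max (R + 1) ((R + 1) * (max K 0) ^ α)))
    refine ⟨S, fun Φ Ξ hl hr hΦ hK => ?_⟩
    obtain ⟨hd, hab, hba⟩ := fderiv_inverse_mul_eq_one hl hr (by simpa using hΦ.contDiff_of_sub_id hα)
      fun x => injective_of_lower_bound (hK x)
    have hb := bound Φ Ξ hab hK
    exact hS _ _ hab hba (fun y => (hb y).trans (le_max_left _ _))
      ((hΦ.fderiv_of_sub_id.comp_lipschitz hα (le_max_right _ _)
        (norm_sub_le_of_fderiv hd hb)).mono (le_max_right _ _))
  | succ n ih =>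
    obtain ⟨S, hS⟩ := ih (2 * R)
    obtain ⟨T, hT⟩ := comp (E := E) (F := E) (G := E →L[ℝ] E) n hα hα1 (max (R + 1) S)
    obtain ⟨U, hU⟩ := inverse (E := E) (A := E →L[ℝ] E) (n + 1) hα hα1 (max (max K 0) T)
    refine ⟨U, fun Φ Ξ hl hr hΦ hK => ?_⟩
    obtain ⟨hd, hab, hba⟩ := fderiv_inverse_mul_eq_one hl hr
      ((hΦ.contDiff_of_sub_id hα).of_le (by norm_cast; omega))
      fun x => injective_of_lower_bound (hK x)
    have h1 := hS Φ Ξ hl hr (hΦ.of_succ hα hα1) hK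
    exact hU _ _ hab hba (fun y => (bound Φ Ξ hab hK y).trans (le_max_left _ _))
      ((hT _ _ (hΦ.fderiv_of_sub_id.mono (le_max_left _ _)) hd
        (h1.mono (le_max_right _ _))).mono (le_max_right _ _))

lemma inverse_sub_id (n : ℕ) (hα : 0 < α) (hα1 : α ≤ 1) (R K : ℝ) :
    ∃ S, ∀ Φ Ξ : E → E, LeftInverse Ξ Φ → RightInverse Ξ Φ →
      HolderBdd (n + 1) α R (fun x => Φ x - x) → (∀ x v, ‖v‖ ≤ K * ‖fderiv ℝ Φ x v‖) →
      HolderBdd (n + 1) α S (fun y => Ξ y - y) := by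
  obtain ⟨S, hS⟩ := fderiv_inverse_bdd (E := E) n hα hα1 R K
  obtain ⟨T, hT⟩ := comp (E := E) (F := E) (G := E) n hα hα1 (max R S)
  refine ⟨T, fun Φ Ξ hl hr hΦ hK => ?_⟩
  have hd := (fderiv_inverse_mul_eq_one hl hr
      ((hΦ.contDiff_of_sub_id hα).of_le (by norm_cast; omega))
      fun x => injective_of_lower_bound (hK x)).1
  have h := (hT _ _ (hΦ.mono (le_max_left _ _)) hd
    ((hS Φ Ξ hl hr hΦ hK).mono (le_max_right _ _))).neg
  have h2 : (fun y => -(Φ (Ξ y) - Ξ y)) = fun y => Ξ y - y := by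
    ext1 y
    rw [hr y, neg_sub]
  rwa [h2] at h

end HolderBdd

end Diffeomorphisms

namespace MemDminus

variable {d n : ℕ} {α β : ℝ} {Φ Ψ : Euc d → Euc d}

lemma exists_holderBdd (h : MemDminus d n β Φ) (hα : 0 < α) (hαβ : α < β) :
    ∃ R, HolderBdd n α R (fun x => Φ x - x) :=
  ⟨_, .of_memCb hα (h.1 α hα hαβ).1⟩

lemma tendsto_sub_id (h : MemDminus d n β Φ) (hβ0 : 0 < β) (hβ1 : β ≤ 1) :
    Tendsto (fun x => Φ x - x) (cocompact _) (𝓝 0) :=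
  ((memC0_iff (half_pos hβ0) (by linarith)).1
    (h.1 (β / 2) (half_pos hβ0) (half_lt_self hβ0))).2

lemma contDiff (h : MemDminus d n β Φ) (hβ0 : 0 < β) : ContDiff ℝ n Φ := by
  obtain ⟨R, hR⟩ := h.exists_holderBdd (half_pos hβ0) (half_lt_self hβ0)
  exact hR.contDiff_of_sub_id (half_pos hβ0)

lemma exists_lower_bound (h : MemDminus d (n + 1) β Φ) (hβ0 : 0 < β) (hβ1 : β ≤ 1) :
    ∃ K, ∀ x v, ‖v‖ ≤ K * ‖fderiv ℝ Φ x v‖ := by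
  obtain ⟨R, hR⟩ := h.exists_holderBdd (half_pos hβ0) (half_lt_self hβ0)
  exact exists_fderiv_lower_bound ((h.contDiff hβ0).of_le (by norm_cast; omega))
    (fun x => (h.2 x).ne')
    (hR.tendsto_fderiv (half_pos hβ0) (by linarith) (h.tendsto_sub_id hβ0 hβ1))

lemma bijective (h : MemDminus d (n + 1) β Φ) (hβ0 : 0 < β) (hβ1 : β ≤ 1) : Bijective Φ := by
  obtain ⟨R, hR⟩ := h.exists_holderBdd (half_pos hβ0) (half_lt_self hβ0)
  obtain ⟨K, hK⟩ := h.exists_lower_bound hβ0 hβ1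
  exact bijective_of_asymptotic_id ((h.contDiff hβ0).of_le (by norm_cast; omega))
    (fun x => injective_of_lower_bound (hK x)) (h.tendsto_sub_id hβ0 hβ1)
    (hR.tendsto_fderiv (half_pos hβ0) (by linarith) (h.tendsto_sub_id hβ0 hβ1))

lemma of_holderBdd (hβ1 : β ≤ 1)
    (hb : ∀ α, 0 < α → α < β → ∃ R, HolderBdd n α R (fun x => Φ x - x))
    (h0 : Tendsto (fun x => Φ x - x) (cocompact _) (𝓝 0))
    (hdet : ∀ x, 0 < LinearMap.det ((fderiv ℝ Φ x : Euc d →L[ℝ] Euc d) : Euc d →ₗ[ℝ] Euc d)) :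
    MemDminus d n β Φ :=
  ⟨fun α hα hαβ => (memC0_iff hα (by linarith)).2 ⟨hb α hα hαβ, h0⟩, hdet⟩

lemma holderBdd_sub (hΦ : MemDminus d n β Φ) (hΨ : MemDminus d n β Ψ) (hα : 0 < α)
    (hαβ : α < β) : HolderBdd n α (hnorm n α (fun x => Φ x - Ψ x)) (fun x => Φ x - Ψ x) := by
  obtain ⟨R, hR⟩ := hΦ.exists_holderBdd hα hαβ
  obtain ⟨S, hS⟩ := hΨ.exists_holderBdd hα hαβ
  have := hR.sub hS
  simp only [sub_sub_sub_cancel_right] at this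
  exact .of_memCb hα (this.memCb hα)

lemma comp (hΦ : MemDminus d (n + 1) β Φ) (hΨ : MemDminus d (n + 1) β Ψ) (hβ0 : 0 < β)
    (hβ1 : β ≤ 1) : MemDminus d (n + 1) β (Φ ∘ Ψ) := by
  refine of_holderBdd hβ1 (fun α hα hαβ => ?_) ?_ fun x => ?_
  · obtain ⟨R, hR⟩ := hΦ.exists_holderBdd hα hαβ
    obtain ⟨T, hT⟩ := hΨ.exists_holderBdd hα hαβ
    obtain ⟨S, hS⟩ := HolderBdd.comp_sub_id (E := Euc d) n hα (by linarith) (max R T)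
    exact ⟨S, hS Φ Ψ (hR.mono (le_max_left _ _)) (hT.mono (le_max_right _ _))⟩
  · have h1 := ((hΦ.tendsto_sub_id hβ0 hβ1).comp (tendsto_cocompact_of_sub_id
      (hΨ.tendsto_sub_id hβ0 hβ1))).add (hΨ.tendsto_sub_id hβ0 hβ1)
    simpa [comp_def] using h1
  · have hd1 : Differentiable ℝ Φ := (hΦ.contDiff hβ0).differentiable (by simp)
    have hd2 : Differentiable ℝ Ψ := (hΨ.contDiff hβ0).differentiable (by simp)
    rw [fderiv_comp x (hd1 _) (hd2 _), ContinuousLinearMap.toLinearMap_comp, LinearMap.det_comp]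
    exact mul_pos (hΦ.2 _) (hΨ.2 _)

lemma inverse (hΦ : MemDminus d (n + 1) β Φ) (hβ0 : 0 < β) (hβ1 : β ≤ 1) :
    MemDminus d (n + 1) β (invFun Φ) := by
  have hbij := hΦ.bijective hβ0 hβ1
  have hl := leftInverse_invFun hbij.1
  have hr := rightInverse_invFun hbij.2
  obtain ⟨K, hK⟩ := hΦ.exists_lower_bound hβ0 hβ1
  have hb : ∀ α, 0 < α → α < β → ∃ R, HolderBdd (n + 1) α R (fun x => invFun Φ x - x) := by
    intro α hα hαβ
    obtain ⟨R, hR⟩ := hΦ.exists_holderBdd hα hαβ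
    obtain ⟨S, hS⟩ := HolderBdd.inverse_sub_id (E := Euc d) n hα (by linarith) R K
    exact ⟨S, hS Φ _ hl hr hR hK⟩
  obtain ⟨hd, hab, -⟩ := fderiv_inverse_mul_eq_one hl hr
    ((hΦ.contDiff hβ0).of_le (by norm_cast; omega)) fun x => injective_of_lower_bound (hK x)
  refine of_holderBdd hβ1 hb ?_ fun x => ?_
  · have hcoc : Tendsto (invFun Φ) (cocompact _) (cocompact _) := by
      intro s hs
      obtain ⟨t, ht, hts⟩ := mem_cocompact.1 hs
      refine mem_cocompact.2 ⟨Φ '' t, ht.image (hΦ.contDiff hβ0).continuous, fun y hy => hts ?_⟩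
      exact fun h => hy ⟨_, h, hr y⟩
    have h1 := ((hΦ.tendsto_sub_id hβ0 hβ1).comp hcoc).neg
    simp only [neg_zero] at h1
    refine h1.congr fun y => ?_
    rw [comp_apply, hr y, neg_sub]
  · have h1 := congrArg (fun A : Euc d →L[ℝ] Euc d => LinearMap.det (A : Euc d →ₗ[ℝ] Euc d))
      (hab x)
    have h2 : LinearMap.det ((fderiv ℝ Φ (invFun Φ x) : Euc d →L[ℝ] Euc d) :
        Euc d →ₗ[ℝ] Euc d) * LinearMap.det ((fderiv ℝ (invFun Φ) x : Euc d →L[ℝ] Euc d) :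
        Euc d →ₗ[ℝ] Euc d) = 1 := by
      rw [← LinearMap.det_comp]
      exact h1.trans LinearMap.det_id
    exact pos_of_mul_pos_right (h2 ▸ one_pos) (hΦ.2 _).le

lemma continuous_comp {Φ₀ Ψ₀ : Euc d → Euc d} (hΦ₀ : MemDminus d (n + 1) β Φ₀)
    (hΨ₀ : MemDminus d (n + 1) β Ψ₀) (hβ1 : β ≤ 1) (hα : 0 < α) (hαβ : α < β) {ε : ℝ}
    (hε : 0 < ε) :
    ∃ α' : ℝ, 0 < α' ∧ α' < β ∧ ∃ δ > (0 : ℝ),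
      ∀ Φ Ψ : Euc d → Euc d, MemDminus d (n + 1) β Φ → MemDminus d (n + 1) β Ψ →
        hnorm (n + 1) α' (fun x => Φ x - Φ₀ x) < δ →
        hnorm (n + 1) α' (fun x => Ψ x - Ψ₀ x) < δ →
        hnorm (n + 1) α (fun x => Φ (Ψ x) - Φ₀ (Ψ₀ x)) < ε := by
  obtain ⟨α', hαα', hα'β⟩ := exists_between hαβ
  have hα' : 0 < α' := hα.trans hαα'
  have hα'1 : α' ≤ 1 := hα'β.le.trans hβ1
  obtain ⟨R, hR⟩ := hΦ₀.exists_holderBdd hα' hα'β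
  obtain ⟨T, hT⟩ := hΨ₀.exists_holderBdd hα' hα'β
  obtain ⟨S, hS⟩ := HolderBdd.comp_sub_id (E := Euc d) n hα' hα'1 (max R T + 1)
  obtain ⟨η, hη, hsmall⟩ := HolderBdd.small_of_norm_le (E := Euc d) (F := Euc d) (n + 1) hα hαα'
    hα'1 (S + S) (half_pos hε)
  have hR0 := hR.nonneg
  have hRT := le_max_left R T
  have hTR := le_max_right R T
  refine ⟨α', hα', hα'β, min 1 (η / (R + 2)), by positivity, fun Φ Ψ hΦ hΨ h1 h2 => ?_⟩
  have hΦb := (hΦ.holderBdd_sub hΦ₀ hα' hα'β).mono h1.le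
  have hΨb := (hΨ.holderBdd_sub hΨ₀ hα' hα'β).mono h2.le
  have hΦR := hΦb.add hR
  have hΨT := hΨb.add hT
  simp only [sub_add_sub_cancel] at hΦR hΨT
  have hm := min_le_left 1 (η / (R + 2))
  have hdiff := (hS Φ Ψ (hΦR.mono (by linarith)) (hΨT.mono (by linarith))).sub
    (hS Φ₀ Ψ₀ (hR.mono (by linarith)) (hT.mono (by linarith)))
  simp only [sub_sub_sub_cancel_right] at hdiff
  refine ((hsmall _ hdiff fun x => ?_).hnorm_le hα).trans_lt (half_lt_self hε)
  have hL := HolderBdd.norm_sub_le_of_fderiv ((hΦ₀.contDiff (hα.trans hαβ)).differentiable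
    (by simp)) hR.fderiv_of_sub_id.norm_le (Ψ x) (Ψ₀ x)
  have hm2 := (le_div_iff₀ (by positivity)).1 (min_le_right 1 (η / (R + 2)))
  calc ‖Φ (Ψ x) - Φ₀ (Ψ₀ x)‖ ≤ ‖Φ (Ψ x) - Φ₀ (Ψ x)‖ + ‖Φ₀ (Ψ x) - Φ₀ (Ψ₀ x)‖ :=
        norm_sub_le_norm_sub_add_norm_sub _ _ _
    _ ≤ min 1 (η / (R + 2)) + (R + 1) * min 1 (η / (R + 2)) := by
        gcongr
        · exact hΦb.norm_le (Ψ x)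
        · exact hL.trans (by gcongr; exact hΨb.norm_le x)
    _ ≤ η := by linarith

lemma continuous_inverse {Φ₀ : Euc d → Euc d} (hΦ₀ : MemDminus d (n + 1) β Φ₀)
    (hβ1 : β ≤ 1) (hα : 0 < α) (hαβ : α < β) {ε : ℝ} (hε : 0 < ε) :
    ∃ α' : ℝ, 0 < α' ∧ α' < β ∧ ∃ δ > (0 : ℝ),
      ∀ Φ : Euc d → Euc d, MemDminus d (n + 1) β Φ →
        hnorm (n + 1) α' (fun x => Φ x - Φ₀ x) < δ →
        hnorm (n + 1) α (fun x => invFun Φ x - invFun Φ₀ x) < ε := by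
  obtain ⟨α', hαα', hα'β⟩ := exists_between hαβ
  have hβ0 : 0 < β := hα.trans hαβ
  have hα' : 0 < α' := hα.trans hαα'
  have hα'1 : α' ≤ 1 := hα'β.le.trans hβ1
  obtain ⟨R, hR⟩ := hΦ₀.exists_holderBdd hα' hα'β
  obtain ⟨K, hK⟩ := hΦ₀.exists_lower_bound hβ0 hβ1
  replace hK : ∀ x v, ‖v‖ ≤ max K 0 * ‖fderiv ℝ Φ₀ x v‖ := fun x v =>
    (hK x v).trans (by gcongr; exact le_max_left _ _)
  have hK0 := le_max_right K 0
  generalize max K 0 = K at hK hK0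
  obtain ⟨S, hS⟩ := HolderBdd.inverse_sub_id (E := Euc d) n hα' hα'1 (R + 1) (2 * K)
  obtain ⟨η, hη, hsmall⟩ := HolderBdd.small_of_norm_le (E := Euc d) (F := Euc d) (n + 1) hα hαα'
    hα'1 (S + S) (half_pos hε)
  have hbij₀ := hΦ₀.bijective hβ0 hβ1
  have hl₀ := leftInverse_invFun hbij₀.1
  have hr₀ := rightInverse_invFun hbij₀.2
  have hΞ₀ := hS Φ₀ _ hl₀ hr₀ (hR.mono (by linarith))
    fun x v => (hK x v).trans (by gcongr; linarith)
  have hS0 := hΞ₀.nonneg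
  obtain ⟨δ, hδ, hδ1, hδK, hδS⟩ : ∃ δ > 0, δ ≤ 1 ∧ K * δ ≤ 1 / 2 ∧ (S + 1) * δ ≤ η := by
    refine ⟨min 1 (min (1 / (2 * (K + 1))) (η / (S + 1))), by positivity, min_le_left _ _, ?_, ?_⟩
    · have := (le_div_iff₀ (by positivity)).1 ((min_le_right 1 _).trans
        (min_le_left (1 / (2 * (K + 1))) (η / (S + 1))))
      have h0 : 0 ≤ min 1 (min (1 / (2 * (K + 1))) (η / (S + 1))) := by positivity
      linarith
    · have := (le_div_iff₀ (by positivity)).1 ((min_le_right 1 _).trans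
        (min_le_right (1 / (2 * (K + 1))) (η / (S + 1))))
      linarith
  refine ⟨α', hα', hα'β, δ, hδ, fun Φ hΦ h1 => ?_⟩
  have hΦb := (hΦ.holderBdd_sub hΦ₀ hα' hα'β).mono h1.le
  have hΦR := hΦb.add hR
  simp only [sub_add_sub_cancel] at hΦR
  have hbij := hΦ.bijective hβ0 hβ1
  have hr := rightInverse_invFun hbij.2
  have hlow : ∀ x v, ‖v‖ ≤ 2 * K * ‖fderiv ℝ Φ x v‖ := by
    intro x v
    have h2 := ContinuousLinearMap.le_of_opNorm_le _ (hΦb.2.2.norm_le x) v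
    rw [fderiv_fun_sub ((hΦ.contDiff hβ0).differentiable (by simp) x)
      ((hΦ₀.contDiff hβ0).differentiable (by simp) x), sub_apply] at h2
    have h3 := norm_sub_norm_le (fderiv ℝ Φ₀ x v) (fderiv ℝ Φ x v)
    rw [norm_sub_rev] at h3
    have h4 : K * ‖fderiv ℝ Φ₀ x v‖ ≤ K * (‖fderiv ℝ Φ x v‖ + δ * ‖v‖) := by
      gcongr
      linarith
    have h5 : K * δ * ‖v‖ ≤ 1 / 2 * ‖v‖ := by gcongr
    linarith [hK x v]
  have hΞ := hS Φ _ (leftInverse_invFun hbij.1) hr (hΦR.mono (by linarith)) hlow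
  have hdiff := hΞ.sub hΞ₀
  simp only [sub_sub_sub_cancel_right] at hdiff
  refine ((hsmall _ hdiff fun y => ?_).hnorm_le hα).trans_lt (half_lt_self hε)
  have hL := HolderBdd.norm_sub_le_of_fderiv (((hΦ₀.inverse hβ0 hβ1).contDiff hβ0).differentiable
    (by simp)) hΞ₀.fderiv_of_sub_id.norm_le (Φ₀ (invFun Φ y)) y
  rw [hl₀] at hL
  have h6 := hΦb.norm_le (invFun Φ y)
  rw [norm_sub_rev, hr y] at h6
  calc ‖invFun Φ y - invFun Φ₀ y‖ ≤ (S + 1) * ‖Φ₀ (invFun Φ y) - y‖ := hL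
    _ ≤ (S + 1) * δ := by gcongr
    _ ≤ η := hδS

end MemDminus

/-- `D^{n,β−}(ℝ^d)` is a topological group under composition
for its natural Fréchet topology, which is generated by the seminorms
`‖·‖_{n,α}`, `0 < α < β` (the corresponding balls form a neighborhood base):
it is closed under composition and inversion, and both operations are
continuous with respect to these seminorms. -/
theorem stmt12 (d n : ℕ) (hn : 1 ≤ n) (β : ℝ) (hβ0 : 0 < β) (hβ1 : β ≤ 1) :
    (∀ Φ Ψ : Euc d → Euc d, MemDminus d n β Φ → MemDminus d n β Ψ →
      MemDminus d n β (Φ ∘ Ψ)) ∧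
    (∀ Φ : Euc d → Euc d, MemDminus d n β Φ → MemDminus d n β (Function.invFun Φ)) ∧
    -- continuity of composition at every pair `(Φ₀, Ψ₀)`
    (∀ Φ₀ Ψ₀ : Euc d → Euc d, MemDminus d n β Φ₀ → MemDminus d n β Ψ₀ →
      ∀ α : ℝ, 0 < α → α < β → ∀ ε > (0 : ℝ),
        ∃ α' : ℝ, 0 < α' ∧ α' < β ∧ ∃ δ > (0 : ℝ),
          ∀ Φ Ψ : Euc d → Euc d, MemDminus d n β Φ → MemDminus d n β Ψ →
            hnorm n α' (fun x => Φ x - Φ₀ x) < δ →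
            hnorm n α' (fun x => Ψ x - Ψ₀ x) < δ →
            hnorm n α (fun x => Φ (Ψ x) - Φ₀ (Ψ₀ x)) < ε) ∧
    -- continuity of inversion at every `Φ₀`
    (∀ Φ₀ : Euc d → Euc d, MemDminus d n β Φ₀ →
      ∀ α : ℝ, 0 < α → α < β → ∀ ε > (0 : ℝ),
        ∃ α' : ℝ, 0 < α' ∧ α' < β ∧ ∃ δ > (0 : ℝ),
          ∀ Φ : Euc d → Euc d, MemDminus d n β Φ →
            hnorm n α' (fun x => Φ x - Φ₀ x) < δ →
            hnorm n α (fun x => Function.invFun Φ x - Function.invFun Φ₀ x) < ε) := by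
  obtain ⟨m, rfl⟩ : ∃ m, n = m + 1 := ⟨n - 1, by omega⟩
  exact ⟨fun Φ Ψ hΦ hΨ => hΦ.comp hΨ hβ0 hβ1, fun Φ hΦ => hΦ.inverse hβ0 hβ1,
    fun Φ₀ Ψ₀ hΦ₀ hΨ₀ α hα hαβ ε hε => hΦ₀.continuous_comp hΨ₀ hβ1 hα hαβ hε,
    fun Φ₀ hΦ₀ α hα hαβ ε hε => hΦ₀.continuous_inverse hβ1 hα hαβ hε⟩
end

section
/- Let n ∈ ℕ with n ≥ 1 and β ∈ (0,1]. Let u : [0,1] × ℝ^d → ℝ^d be a pointwise time-dependent C^{n,β}_0-vector field. Then u has a unique pointwise flow Φ : [0,1] × ℝ^d → ℝ^d, i.e., Φ(t,x) = x + ∫₀ᵗ u(s,Φ(s,x)) ds for all t ∈ [0,1] and x ∈ ℝ^d, such that Φ(t,·) ∈ D^{n,β}(ℝ^d) for every t ∈ [0,1] and the map t ↦ Φ(t,·) − Id is continuous from [0,1] into C^{n,β}_0(ℝ^d,ℝ^d). -/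
open Function Set Filter Topology MeasureTheory
open scoped ENNReal NNReal

/-- A pointwise time-dependent `C^{n,β}_0`-vector field on `[0,1]`:
`u(t,·) ∈ C^{n,β}_0` for all `t ∈ [0,1]`, `u(·,x)` is measurable on `[0,1]`
for all `x`, and `t ↦ ‖u(t,·)‖_{n,β}` is integrable on `[0,1]`. -/
def PointwiseVF (d n : ℕ) (β : ℝ) (u : ℝ → Euc d → Euc d) : Prop :=
  (∀ t ∈ Icc (0 : ℝ) 1, MemC0 n β (u t)) ∧
  (∀ x, AEStronglyMeasurable (fun t => u t x) (volume.restrict (Icc (0 : ℝ) 1))) ∧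
  IntegrableOn (fun t => hnorm n β (u t)) (Icc (0 : ℝ) 1)

/-- `Φ` is a pointwise flow of `u` on `[0,1]`:
`Φ(t,x) = x + ∫₀ᵗ u(s,Φ(s,x)) ds` (with integrable integrand). -/
def IsPointwiseFlow {d : ℕ} (u Φ : ℝ → Euc d → Euc d) : Prop :=
  ∀ x, IntervalIntegrable (fun s => u s (Φ s x)) volume 0 1 ∧
    ∀ t ∈ Icc (0 : ℝ) 1, Φ t x = x + ∫ s in (0 : ℝ)..t, u s (Φ s x)

section HolderBound

universe v

variable {E F G H : Type v} [NormedAddCommGroup E] [NormedSpace ℝ E]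
  [NormedAddCommGroup F] [NormedSpace ℝ F] [NormedAddCommGroup G] [NormedSpace ℝ G]
  [NormedAddCommGroup H] [NormedSpace ℝ H]

/-- `f` is `n` times differentiable, its derivatives of order at most `n` are bounded by `M`, and
its `n`-th derivative is `β`-Hölder with constant `M`; defined by recursion on `n`. -/
def HolderBound (β : ℝ) {E : Type v} [NormedAddCommGroup E] [NormedSpace ℝ E] :
    (n : ℕ) → {F : Type v} → [NormedAddCommGroup F] → [NormedSpace ℝ F] → ℝ → (E → F) → Prop
  | 0, _, _, _, M, f => (∀ x, ‖f x‖ ≤ M) ∧ ∀ x y, ‖f x - f y‖ ≤ M * ‖x - y‖ ^ β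
  | n + 1, _, _, _, M, f =>
    Differentiable ℝ f ∧ (∀ x, ‖f x‖ ≤ M) ∧ HolderBound β n M (fderiv ℝ f)

variable {β : ℝ} {n : ℕ} {M M' : ℝ} {f g : E → F}

lemma HolderBound.norm_le (h : HolderBound β n M f) (x : E) : ‖f x‖ ≤ M := by
  cases n with
  | zero => exact h.1 x
  | succ n => exact h.2.1 x

lemma HolderBound.nonneg (h : HolderBound β n M f) : 0 ≤ M :=
  (norm_nonneg _).trans (h.norm_le 0)

lemma HolderBound.mono (h : HolderBound β n M f) (hM : M ≤ M') : HolderBound β n M' f := by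
  induction n generalizing F with
  | zero => exact ⟨fun x => (h.1 x).trans hM, fun x y => (h.2 x y).trans (by gcongr)⟩
  | succ n ih => exact ⟨h.1, fun x => (h.2.1 x).trans hM, ih h.2.2⟩

lemma HolderBound.neg (h : HolderBound β n M f) : HolderBound β n M (fun x => -f x) := by
  induction n generalizing F with
  | zero =>
    refine ⟨fun x => by simpa using h.1 x, fun x y => ?_⟩
    rw [neg_sub_neg, norm_sub_rev]
    exact h.2 x y
  | succ n ih =>
    refine ⟨h.1.neg, fun x => by simpa using h.2.1 x, ?_⟩
    have : fderiv ℝ (fun x => -f x) = fun x => -fderiv ℝ f x := by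
      ext1 x; exact fderiv_fun_neg
    rw [this]
    exact ih h.2.2

lemma HolderBound.add (hf : HolderBound β n M f) (hg : HolderBound β n M' g) :
    HolderBound β n (M + M') (fun x => f x + g x) := by
  induction n generalizing F with
  | zero =>
    refine ⟨fun x => (norm_add_le _ _).trans (add_le_add (hf.1 x) (hg.1 x)), fun x y => ?_⟩
    rw [add_sub_add_comm, add_mul]
    exact (norm_add_le _ _).trans (add_le_add (hf.2 x y) (hg.2 x y))
  | succ n ih =>
    refine ⟨hf.1.add hg.1, fun x => (norm_add_le _ _).trans (add_le_add (hf.2.1 x) (hg.2.1 x)), ?_⟩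
    have : fderiv ℝ (fun x => f x + g x) = fun x => fderiv ℝ f x + fderiv ℝ g x := by
      ext1 x; exact fderiv_fun_add (hf.1 x) (hg.1 x)
    rw [this]
    exact ih hf.2.2 hg.2.2

lemma holderBound_const (c : F) : HolderBound β n ‖c‖ (fun _ : E => c) := by
  induction n generalizing F with
  | zero => exact ⟨fun x => le_rfl, fun x y => by simp; positivity⟩
  | succ n ih =>
    refine ⟨differentiable_const c, fun x => le_rfl, ?_⟩
    have : fderiv ℝ (fun _ : E => c) = fun _ => 0 := by ext1 x; simp
    rw [this]
    exact (ih (0 : E →L[ℝ] F)).mono (by simp)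

/-- A bounded Lipschitz function is Hölder. -/
lemma holderBound_zero_of_lipschitz (hβ0 : 0 < β) (hβ1 : β ≤ 1) (hb : ∀ x, ‖f x‖ ≤ M)
    (hl : ∀ x y, ‖f x - f y‖ ≤ M * ‖x - y‖) : HolderBound β 0 (2 * M) f := by
  have hM : 0 ≤ M := (norm_nonneg _).trans (hb 0)
  refine ⟨fun x => (hb x).trans (by linarith), fun x y => ?_⟩
  rcases le_total ‖x - y‖ 1 with h | h
  · have h1 : ‖x - y‖ ≤ ‖x - y‖ ^ β := by
      simpa using Real.rpow_le_rpow_of_exponent_ge' (norm_nonneg _) h hβ0.le hβ1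
    calc ‖f x - f y‖ ≤ M * ‖x - y‖ := hl x y
      _ ≤ M * ‖x - y‖ ^ β := by gcongr
      _ ≤ 2 * M * ‖x - y‖ ^ β := by
        have := mul_nonneg hM (Real.rpow_nonneg (norm_nonneg (x - y)) β)
        linarith
  · have h1 : 1 ≤ ‖x - y‖ ^ β := Real.one_le_rpow h hβ0.le
    calc ‖f x - f y‖ ≤ ‖f x‖ + ‖f y‖ := norm_sub_le _ _
      _ ≤ 2 * M * 1 := by linarith [hb x, hb y]
      _ ≤ 2 * M * ‖x - y‖ ^ β := by gcongr

lemma HolderBound.lipschitz (h : HolderBound β (n + 1) M f) (x y : E) :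
    ‖f x - f y‖ ≤ M * ‖x - y‖ :=
  convex_univ.norm_image_sub_le_of_norm_fderiv_le (fun z _ => h.1 z)
    (fun z _ => h.2.2.norm_le z) (mem_univ y) (mem_univ x)

lemma HolderBound.of_succ (hβ0 : 0 < β) (hβ1 : β ≤ 1) (h : HolderBound β (n + 1) M f) :
    HolderBound β n (2 * M) f := by
  induction n generalizing F with
  | zero => exact holderBound_zero_of_lipschitz hβ0 hβ1 h.2.1 h.lipschitz
  | succ n ih => exact ⟨h.1, fun x => (h.2.1 x).trans (by linarith [h.nonneg]), ih h.2.2⟩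

lemma HolderBound.to_zero (hβ0 : 0 < β) (hβ1 : β ≤ 1) (h : HolderBound β n M f) :
    HolderBound β 0 (2 * M) f := by
  cases n with
  | zero => exact h.mono (by linarith [h.nonneg])
  | succ n => exact holderBound_zero_of_lipschitz hβ0 hβ1 h.2.1 h.lipschitz

lemma HolderBound.bilinear (hβ0 : 0 < β) (hβ1 : β ≤ 1) (B : F →L[ℝ] G →L[ℝ] H)
    {f : E → F} {g : E → G} (hf : HolderBound β n M f) (hg : HolderBound β n M' g) :
    HolderBound β n (2 * 4 ^ n * ‖B‖ * M * M') (fun x => B (f x) (g x)) := by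
  have hM := hf.nonneg
  have hM' := hg.nonneg
  have hbd : ∀ x, ‖B (f x) (g x)‖ ≤ ‖B‖ * M * M' := fun x =>
    (B.le_opNorm₂ _ _).trans (by gcongr <;> [exact hf.norm_le x; exact hg.norm_le x])
  have hb0 : 0 ≤ ‖B‖ * M * M' := by positivity
  induction n generalizing F G H M M' with
  | zero =>
    refine ⟨fun x => (hbd x).trans (by linarith), fun x y => ?_⟩
    have : B (f x) (g x) - B (f y) (g y) = B (f x) (g x - g y) + B (f x - f y) (g y) := by
      simp
    rw [this]
    calc _ ≤ ‖B‖ * ‖f x‖ * ‖g x - g y‖ + ‖B‖ * ‖f x - f y‖ * ‖g y‖ :=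
          (norm_add_le _ _).trans (add_le_add (B.le_opNorm₂ _ _) (B.le_opNorm₂ _ _))
      _ ≤ ‖B‖ * M * (M' * ‖x - y‖ ^ β) + ‖B‖ * (M * ‖x - y‖ ^ β) * M' := by
          gcongr
          exacts [hf.1 x, hg.2 x y, hf.2 x y, hg.1 y]
      _ = _ := by ring
  | succ n ih =>
    have h4 : (1 : ℝ) ≤ 4 ^ (n + 1) := one_le_pow₀ (by norm_num)
    refine ⟨fun x => ((B.hasFDerivAt_of_bilinear (hf.1 x).hasFDerivAt
      (hg.1 x).hasFDerivAt)).differentiableAt, fun x => (hbd x).trans ?_, ?_⟩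
    · nlinarith [mul_le_mul_of_nonneg_right h4 hb0]
    · have : fderiv ℝ (fun x => B (f x) (g x)) = fun x =>
          B.precompR E (f x) (fderiv ℝ g x) + B.precompL E (fderiv ℝ f x) (g x) := by
        ext1 x; exact B.fderiv_of_bilinear (hf.1 x) (hg.1 x)
      rw [this]
      have key : ∀ {F G H : Type v} [NormedAddCommGroup F] [NormedSpace ℝ F]
          [NormedAddCommGroup G] [NormedSpace ℝ G] [NormedAddCommGroup H] [NormedSpace ℝ H]
          (B' : F →L[ℝ] G →L[ℝ] H) {f : E → F} {g : E → G} {a b : ℝ},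
          HolderBound β n a f → HolderBound β n b g →
          HolderBound β n (2 * 4 ^ n * ‖B'‖ * a * b) (fun x => B' (f x) (g x)) := by
        intro F G H _ _ _ _ _ _ B' f g a b hf hg
        have ha := hf.nonneg
        have hb := hg.nonneg
        exact ih B' hf hg ha hb (fun x =>
          (B'.le_opNorm₂ _ _).trans (by gcongr <;> [exact hf.norm_le x; exact hg.norm_le x]))
          (by positivity)
      refine ((key (B.precompR E) (hf.of_succ hβ0 hβ1) hg.2.2).add
        (key (B.precompL E) hf.2.2 (hg.of_succ hβ0 hβ1))).mono ?_
      have h1 := B.norm_precompR_le E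
      have h2 := B.norm_precompL_le E
      calc _ ≤ 2 * 4 ^ n * ‖B‖ * (2 * M) * M' + 2 * 4 ^ n * ‖B‖ * M * (2 * M') := by gcongr
        _ = _ := by ring

/-- The constant in the composition estimate `HolderBound.comp_id_add`. -/
def compConst : ℕ → ℝ → ℝ
  | 0, M => 1 + M
  | n + 1, M => 1 + 2 * 4 ^ n * compConst n (2 * M) * (1 + M)

lemma one_le_compConst (n : ℕ) {M : ℝ} (hM : 0 ≤ M) : 1 ≤ compConst n M := by
  induction n generalizing M with
  | zero => simp [compConst, hM]
  | succ n ih =>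
    have := ih (M := 2 * M) (by positivity)
    have : 0 ≤ 2 * 4 ^ n * compConst n (2 * M) * (1 + M) := by positivity
    simp only [compConst]
    linarith

/-- Composition with a perturbation of the identity. -/
lemma HolderBound.comp_id_add (hβ0 : 0 < β) (hβ1 : β ≤ 1) {u : E → F} {ψ : E → E} {a : ℝ}
    (hu : HolderBound β n a u) (hψ : HolderBound β n M ψ)
    (hl : ∀ x y, ‖ψ x - ψ y‖ ≤ M * ‖x - y‖) :
    HolderBound β n (compConst n M * a) (fun x => u (x + ψ x)) := by
  have hM := hψ.nonneg
  have ha := hu.nonneg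
  have hC := one_le_compConst n hM
  induction n generalizing F M a with
  | zero =>
    refine ⟨fun x => (hu.1 _).trans (by nlinarith), fun x y => (hu.2 _ _).trans ?_⟩
    have h1 : ‖x + ψ x - (y + ψ y)‖ ≤ (1 + M) * ‖x - y‖ := by
      rw [add_sub_add_comm]
      linarith [norm_add_le (x - y) (ψ x - ψ y), hl x y]
    have h2 : (1 + M) ^ β ≤ 1 + M := by
      simpa using Real.rpow_le_rpow_of_exponent_le (by linarith : 1 ≤ 1 + M) hβ1
    calc a * ‖x + ψ x - (y + ψ y)‖ ^ β ≤ a * ((1 + M) * ‖x - y‖) ^ β := by gcongr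
      _ = a * ((1 + M) ^ β * ‖x - y‖ ^ β) := by
        rw [Real.mul_rpow (by positivity) (by positivity)]
      _ ≤ a * ((1 + M) * ‖x - y‖ ^ β) := by gcongr
      _ = _ := by simp only [compConst]; ring
  | succ n ih =>
    have hd : ∀ x, HasFDerivAt (fun x => x + ψ x) (.id ℝ E + fderiv ℝ ψ x) x := fun x =>
      (hasFDerivAt_id x).add (hψ.1 x).hasFDerivAt
    have hdu : ∀ x, HasFDerivAt (fun x => u (x + ψ x))
        ((fderiv ℝ u (x + ψ x)).comp (.id ℝ E + fderiv ℝ ψ x)) x := fun x =>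
      (hu.1 (x + ψ x)).hasFDerivAt.comp x (hd x)
    refine ⟨fun x => (hdu x).differentiableAt, fun x => (hu.2.1 _).trans (by nlinarith), ?_⟩
    have : fderiv ℝ (fun x => u (x + ψ x)) = fun x =>
        ContinuousLinearMap.compL ℝ E E F (fderiv ℝ u (x + ψ x)) (.id ℝ E + fderiv ℝ ψ x) := by
      ext1 x; exact (hdu x).fderiv
    rw [this]
    have hC' := one_le_compConst n (M := 2 * M) (by positivity)
    have h1 := ih hu.2.2 (hψ.of_succ hβ0 hβ1)
      (fun x y => (hl x y).trans (by gcongr; linarith)) (by positivity) ha hC'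
    have h2 : HolderBound β n (1 + M) (fun x => .id ℝ E + fderiv ℝ ψ x) :=
      ((holderBound_const _).add hψ.2.2).mono
        (by gcongr; exact ContinuousLinearMap.norm_id_le)
    refine (h1.bilinear hβ0 hβ1 _ h2).mono ?_
    have h3 := ContinuousLinearMap.norm_compL_le ℝ E E F
    calc _ ≤ 2 * 4 ^ n * 1 * (compConst n (2 * M) * a) * (1 + M) := by gcongr
      _ ≤ _ := by simp only [compConst]; nlinarith

lemma HolderBound.comp_id_add' (hβ0 : 0 < β) (hβ1 : β ≤ 1) (hn : 1 ≤ n) {u : E → F} {ψ : E → E}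
    {a : ℝ} (hu : HolderBound β n a u) (hψ : HolderBound β n M ψ) :
    HolderBound β n (compConst n M * a) (fun x => u (x + ψ x)) := by
  obtain ⟨n, rfl⟩ := Nat.exists_eq_add_of_le' hn
  exact hu.comp_id_add hβ0 hβ1 hψ hψ.lipschitz

/-- Interpolation: the derivative is controlled by the function and the Hölder seminorm of the
derivative. -/
lemma norm_fderiv_le_of_holder (hβ : 0 < β) (hf : Differentiable ℝ f)
    (hH : ∀ x y, ‖fderiv ℝ f x - fderiv ℝ f y‖ ≤ M * ‖x - y‖ ^ β) (hM : 0 ≤ M)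
    {r η : ℝ} (hr : 0 < r) {x : E} (hη : ∀ y ∈ Metric.closedBall x r, ‖f y‖ ≤ η) :
    ‖fderiv ℝ f x‖ ≤ 2 * η / r + M * r ^ β := by
  have hη0 : 0 ≤ η := (norm_nonneg _).trans (hη x (Metric.mem_closedBall_self hr.le))
  refine ContinuousLinearMap.opNorm_le_of_unit_norm (by positivity) fun v hv => ?_
  have hx : x ∈ Metric.closedBall x r := Metric.mem_closedBall_self hr.le
  have hnr : ‖r • v‖ = r := by rw [norm_smul, hv, Real.norm_of_nonneg hr.le, mul_one]
  have hy : x + r • v ∈ Metric.closedBall x r := by simp [hnr]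
  have h1 := (convex_closedBall x r).norm_image_sub_le_of_norm_hasFDerivWithin_le'
    (φ := fderiv ℝ f x) (C := M * r ^ β) (fun z _ => (hf z).hasFDerivAt.hasFDerivWithinAt)
    (fun z hz => (hH z x).trans (by
      gcongr
      rwa [Metric.mem_closedBall, dist_eq_norm] at hz)) hx hy
  rw [add_sub_cancel_left, hnr] at h1
  have h2 : ‖fderiv ℝ f x (r • v)‖ ≤ 2 * η + M * r ^ β * r := by
    have h3 : fderiv ℝ f x (r • v) = (f (x + r • v) - f x)
        - (f (x + r • v) - f x - fderiv ℝ f x (r • v)) := by abel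
    rw [h3]
    linarith [norm_sub_le (f (x + r • v) - f x) (f (x + r • v) - f x - fderiv ℝ f x (r • v)),
      norm_sub_le (f (x + r • v)) (f x), hη _ hx, hη _ hy]
  rw [map_smul, norm_smul, Real.norm_of_nonneg hr.le] at h2
  have : 2 * η / r + M * r ^ β = (2 * η + M * r ^ β * r) / r := by field_simp
  rw [this, le_div_iff₀ hr]
  linarith

lemma exists_pos_mul_rpow_lt (hβ : 0 < β) (M : ℝ) {ε : ℝ} (hε : 0 < ε) :
    ∃ r > 0, M * r ^ β < ε := by
  have h : Tendsto (fun r : ℝ => M * r ^ β) (𝓝[>] 0) (𝓝 (M * 0 ^ β)) :=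
    ((Real.continuous_rpow_const hβ.le).tendsto 0 |>.const_mul M).mono_left nhdsWithin_le_nhds
  rw [Real.zero_rpow hβ.ne', mul_zero] at h
  obtain ⟨r, hr, hr'⟩ := ((h.eventually_lt_const hε).and self_mem_nhdsWithin).exists
  exact ⟨r, hr', hr⟩

/-- Uniform limits preserve Hölder bounds. -/
lemma HolderBound.of_tendstoUniformly [CompleteSpace F] (hβ0 : 0 < β) (hβ1 : β ≤ 1)
    {f : ℕ → E → F} {f₀ : E → F} (hf : ∀ k, HolderBound β n M (f k))
    (hlim : TendstoUniformly f f₀ atTop) : HolderBound β n M f₀ := by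
  have hpt : ∀ x, Tendsto (fun k => f k x) atTop (𝓝 (f₀ x)) := fun x => hlim.tendsto_at x
  have hbd : ∀ x, ‖f₀ x‖ ≤ M := fun x =>
    le_of_tendsto (hpt x).norm (Eventually.of_forall fun k => (hf k).norm_le x)
  induction n generalizing F with
  | zero =>
    exact ⟨hbd, fun x y => le_of_tendsto ((hpt x).sub (hpt y)).norm
      (Eventually.of_forall fun k => (hf k).2 x y)⟩
  | succ n ih =>
    have hM : 0 ≤ M := (hf 0).nonneg
    have hcau : ∀ ε > 0, ∃ N, ∀ m ≥ N, ∀ k ≥ N, ∀ x,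
        dist (fderiv ℝ (f m) x) (fderiv ℝ (f k) x) < ε := by
      intro ε hε
      obtain ⟨r, hr, hr'⟩ := exists_pos_mul_rpow_lt hβ0 (2 * M + 2 * M) (half_pos hε)
      have hη : 0 < ε * r / 8 := by positivity
      obtain ⟨N, hN⟩ := eventually_atTop.1 (Metric.tendstoUniformly_iff.1 hlim _ hη)
      refine ⟨N, fun m hm k hk x => ?_⟩
      have hsub : fderiv ℝ (fun y => f m y - f k y) =
          fun y => fderiv ℝ (f m) y - fderiv ℝ (f k) y := by
        ext1 y; exact fderiv_fun_sub ((hf m).1 y) ((hf k).1 y)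
      have h := norm_fderiv_le_of_holder (f := fun y => f m y - f k y) (M := 2 * M + 2 * M)
        (η := 2 * (ε * r / 8)) hβ0 ((hf m).1.sub (hf k).1) (fun y z => by
          have h1 := ((hf m).2.2.to_zero hβ0 hβ1).2 y z
          have h2 := ((hf k).2.2.to_zero hβ0 hβ1).2 y z
          rw [hsub, sub_sub_sub_comm, add_mul]
          exact (norm_sub_le _ _).trans (add_le_add h1 h2)) (by positivity) hr (x := x)
        (fun y _ => by
          have h1 := hN m hm y
          have h2 := hN k hk y
          rw [← dist_eq_norm]
          linarith [dist_triangle_left (f m y) (f k y) (f₀ y)])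
      rw [hsub] at h
      rw [dist_eq_norm]
      have : 2 * (2 * (ε * r / 8)) / r = ε / 2 := by field_simp; norm_num
      linarith
    have hex : ∀ x, ∃ L, Tendsto (fun k => fderiv ℝ (f k) x) atTop (𝓝 L) := fun x =>
      cauchySeq_tendsto_of_complete (Metric.cauchySeq_iff.2 fun ε hε => by
        obtain ⟨N, hN⟩ := hcau ε hε
        exact ⟨N, fun m hm k hk => hN m hm k hk x⟩)
    choose f' hf' using hex
    have hunif : TendstoUniformly (fun k => fderiv ℝ (f k)) f' atTop := by
      rw [← tendstoUniformlyOn_univ]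
      refine UniformCauchySeqOn.tendstoUniformlyOn_of_tendsto
        (Metric.uniformCauchySeqOn_iff.2 fun ε hε => ?_) (fun x _ => hf' x)
      obtain ⟨N, hN⟩ := hcau ε hε
      exact ⟨N, fun m hm k hk x _ => hN m hm k hk x⟩
    have hd : ∀ x, HasFDerivAt f₀ (f' x) x := hasFDerivAt_of_tendstoUniformly hunif
      (fun k x => ((hf k).1 x).hasFDerivAt) hpt
    have hfd : fderiv ℝ f₀ = f' := funext fun x => (hd x).fderiv
    refine ⟨fun x => (hd x).differentiableAt, hbd, ?_⟩
    rw [hfd]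
    exact ih (fun k => (hf k).2.2) hunif hf' (fun x => le_of_tendsto (hf' x).norm
      (Eventually.of_forall fun k => (hf k).2.2.norm_le x))

lemma HolderBound.tendsto_fderiv_cocompact [ProperSpace E] (hβ0 : 0 < β) (hβ1 : β ≤ 1)
    (hf : HolderBound β (n + 1) M f) (h0 : Tendsto f (cocompact E) (𝓝 0)) :
    Tendsto (fderiv ℝ f) (cocompact E) (𝓝 0) := by
  rw [← Metric.cobounded_eq_cocompact] at h0 ⊢
  rw [Metric.tendsto_nhds] at h0 ⊢
  intro ε hε
  have hM := hf.nonneg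
  obtain ⟨r, hr, hr'⟩ := exists_pos_mul_rpow_lt hβ0 (2 * M) (half_pos hε)
  have h1 := h0 (ε * r / 4) (by positivity)
  rw [← comap_norm_atTop, eventually_comap] at h1
  obtain ⟨R, hR⟩ := eventually_atTop.1 h1
  filter_upwards [tendsto_norm_cobounded_atTop.eventually_ge_atTop (R + r)] with x hx
  rw [dist_zero_right]
  have := norm_fderiv_le_of_holder hβ0 hf.1 (hf.2.2.to_zero hβ0 hβ1).2 (by positivity) hr
    (x := x) (η := ε * r / 4) (fun y hy => by
      have h2 := hR ‖y‖ (by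
        rw [Metric.mem_closedBall, dist_eq_norm, norm_sub_rev] at hy
        linarith [norm_sub_norm_le x y]) y rfl
      rw [dist_zero_right] at h2
      exact h2.le)
  have h3 : 2 * (ε * r / 4) / r = ε / 2 := by field_simp; norm_num
  linarith

lemma HolderBound.tendsto_iteratedFDeriv [ProperSpace E] (hβ0 : 0 < β) (hβ1 : β ≤ 1)
    (hf : HolderBound β n M f) (h0 : Tendsto f (cocompact E) (𝓝 0)) {l : ℕ} (hl : l ≤ n) :
    Tendsto (fun x => ‖iteratedFDeriv ℝ l f x‖) (cocompact E) (𝓝 0) := by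
  induction l generalizing F n with
  | zero => simpa using h0.norm
  | succ l ih =>
    obtain ⟨n, rfl⟩ := Nat.exists_eq_add_of_le' (Nat.one_le_of_lt hl)
    simp_rw [← norm_iteratedFDeriv_fderiv]
    exact ih hf.2.2 (hf.tendsto_fderiv_cocompact hβ0 hβ1 h0) (by omega)

lemma norm_iteratedFDeriv_fderiv_sub (f : E → F) (x y : E) :
    ‖iteratedFDeriv ℝ n (fderiv ℝ f) x - iteratedFDeriv ℝ n (fderiv ℝ f) y‖ =
      ‖iteratedFDeriv ℝ (n + 1) f x - iteratedFDeriv ℝ (n + 1) f y‖ := by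
  simp only [iteratedFDeriv_succ_eq_comp_right, Function.comp_apply, ← dist_eq_norm]
  exact (LinearIsometryEquiv.dist_map _ _ _).symm

lemma holderBound_iff (hβ : 0 < β) : HolderBound β n M f ↔ ContDiff ℝ (n : ℕ∞) f ∧
    (∀ l ≤ n, ∀ x, ‖iteratedFDeriv ℝ l f x‖ ≤ M) ∧
    ∀ x y, ‖iteratedFDeriv ℝ n f x - iteratedFDeriv ℝ n f y‖ ≤ M * ‖x - y‖ ^ β := by
  induction n generalizing F with
  | zero =>
    have hs : ∀ x y, ‖iteratedFDeriv ℝ 0 f x - iteratedFDeriv ℝ 0 f y‖ = ‖f x - f y‖ := by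
      intro x y
      simp only [iteratedFDeriv_zero_eq_comp, Function.comp_apply]
      rw [← map_sub, LinearIsometryEquiv.norm_map]
    simp only [HolderBound, hs, Nat.le_zero, forall_eq, norm_iteratedFDeriv_zero]
    refine ⟨fun h => ⟨?_, h⟩, fun h => h.2⟩
    rw [Nat.cast_zero, WithTop.coe_zero, contDiff_zero, continuous_iff_continuousAt]
    intro x
    rw [ContinuousAt, tendsto_iff_norm_sub_tendsto_zero]
    refine squeeze_zero (fun _ => norm_nonneg _) (fun y => h.2 y x) ?_
    have : Continuous fun y => M * ‖y - x‖ ^ β :=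
      continuous_const.mul ((Real.continuous_rpow_const hβ.le).comp (by fun_prop))
    simpa [Real.zero_rpow hβ.ne'] using this.tendsto x
  | succ n ih =>
    have hc : ContDiff ℝ ((n + 1 : ℕ) : ℕ∞) f ↔
        Differentiable ℝ f ∧ ContDiff ℝ (n : ℕ∞) (fderiv ℝ f) := by
      have : (((n + 1 : ℕ) : ℕ∞) : WithTop ℕ∞) = ((n : ℕ∞) : WithTop ℕ∞) + 1 := by simp
      rw [this, contDiff_succ_iff_fderiv]
      simp
    simp only [HolderBound]
    rw [ih, hc]
    simp only [norm_iteratedFDeriv_fderiv, norm_iteratedFDeriv_fderiv_sub]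
    constructor
    · rintro ⟨h1, h2, h3, h4, h5⟩
      refine ⟨⟨h1, h3⟩, fun l hl x => ?_, h5⟩
      cases l with
      | zero => simpa using h2 x
      | succ l => exact h4 l (by omega) x
    · rintro ⟨⟨h1, h3⟩, h4, h5⟩
      exact ⟨h1, fun x => by simpa using h4 0 (by omega) x, h3,
        fun l hl x => h4 (l + 1) (by omega) x, h5⟩

lemma HolderBound.eHnorm_le (hβ : 0 < β) (h : HolderBound β n M f) :
    eHnorm n β f ≤ ENNReal.ofReal M := by
  obtain ⟨-, h1, h2⟩ := (holderBound_iff hβ).1 h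
  refine max_le (iSup_le fun l => iSup_le fun x => ?_)
    (iSup_le fun x => iSup_le fun y => iSup_le fun hxy => ?_)
  · rw [← enorm_eq_nnnorm, ← ofReal_norm]
    exact ENNReal.ofReal_le_ofReal (h1 _ (Nat.le_of_lt_succ l.2) x)
  · refine ENNReal.div_le_of_le_mul ?_
    rw [← enorm_eq_nnnorm, ← ofReal_norm, edist_dist, dist_eq_norm,
      ENNReal.ofReal_rpow_of_nonneg (norm_nonneg _) hβ.le, ← ENNReal.ofReal_mul h.nonneg]
    exact ENNReal.ofReal_le_ofReal (h2 x y)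

lemma HolderBound.hnorm_le (hβ : 0 < β) (h : HolderBound β n M f) : hnorm n β f ≤ M :=
  ENNReal.toReal_le_of_le_ofReal h.nonneg (h.eHnorm_le hβ)

lemma MemCb.holderBound (hβ : 0 < β) (h : MemCb n β f) : HolderBound β n (hnorm n β f) f := by
  have hlt := h.2
  refine (holderBound_iff hβ).2 ⟨h.1, fun l hl x => ?_, fun x y => ?_⟩
  · have h1 : (‖iteratedFDeriv ℝ l f x‖₊ : ℝ≥0∞) ≤ eHnorm n β f :=
      (le_iSup₂ (f := fun (l : Fin (n + 1)) x => (‖iteratedFDeriv ℝ (l : ℕ) f x‖₊ : ℝ≥0∞))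
        ⟨l, Nat.lt_succ_of_le hl⟩ x).trans (le_max_left _ _)
    simpa [hnorm] using ENNReal.toReal_mono hlt.ne h1
  · rcases eq_or_ne x y with rfl | hxy
    · simp [Real.zero_rpow hβ.ne']
    have h1 : (‖iteratedFDeriv ℝ n f x - iteratedFDeriv ℝ n f y‖₊ : ℝ≥0∞) / edist x y ^ β ≤
        eHnorm n β f :=
      le_trans (le_iSup_of_le x (le_iSup_of_le y
        (le_iSup (fun _ : x ≠ y => (‖iteratedFDeriv ℝ n f x - iteratedFDeriv ℝ n f y‖₊ : ℝ≥0∞) /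
          edist x y ^ β) hxy))) (le_max_right _ _)
    have h2 := ENNReal.toReal_mono hlt.ne h1
    have hpos : 0 < ‖x - y‖ ^ β := Real.rpow_pos_of_pos (norm_pos_iff.2 (sub_ne_zero.2 hxy)) _
    rw [ENNReal.toReal_div, ← ENNReal.toReal_rpow, edist_dist, dist_eq_norm,
      ENNReal.toReal_ofReal (norm_nonneg _), div_le_iff₀ hpos] at h2
    simpa [hnorm] using h2

end HolderBound

section ParametricIntegral

universe v

variable {α : Type*} [MeasurableSpace α] {μ : Measure α}

/-- A Carathéodory function composed with a measurable function is measurable. -/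
lemma aestronglyMeasurable_comp_of_continuous {E F : Type*} [NormedAddCommGroup E]
    [NormedAddCommGroup F] {u : α → E → F} {φ : α → E}
    (hm : ∀ x, AEStronglyMeasurable (fun s => u s x) μ) (hc : ∀ᵐ s ∂μ, Continuous (u s))
    (hφ : AEStronglyMeasurable φ μ) : AEStronglyMeasurable (fun s => u s (φ s)) μ := by
  obtain ⟨ψ, hψ, hφψ⟩ := hφ
  refine aestronglyMeasurable_of_tendsto_ae atTop (f := fun k s => u s (hψ.approx k s))
    (fun k => ?_) ?_
  · have : (fun s => u s (hψ.approx k s)) = fun s => ∑ y ∈ (hψ.approx k).range,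
        (hψ.approx k ⁻¹' {y}).indicator (fun s => u s y) s := by
      ext1 s
      rw [Finset.sum_eq_single (hψ.approx k s)]
      · simp
      · intro y _ hy
        exact indicator_of_notMem (fun h => hy h.symm) _
      · intro h
        exact absurd (SimpleFunc.mem_range_self _ _) h
    rw [this]
    exact Finset.aestronglyMeasurable_fun_sum _ fun y _ =>
      (hm y).indicator ((hψ.approx k).measurableSet_fiber y)
  · filter_upwards [hc, hφψ] with s hs hs'
    rw [hs']
    exact (hs.tendsto _).comp (hψ.tendsto_approx s)

variable {E F : Type v} [NormedAddCommGroup E] [NormedSpace ℝ E] [NormedAddCommGroup F] [NormedSpace ℝ F]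

lemma aestronglyMeasurable_clm [FiniteDimensional ℝ E] {L : α → E →L[ℝ] F}
    (h : ∀ v, AEStronglyMeasurable (fun s => L s v) μ) : AEStronglyMeasurable L μ := by
  let b := Module.finBasis ℝ E
  let c : _ → E →L[ℝ] ℝ := fun i => LinearMap.toContinuousLinearMap (b.coord i)
  have : L = fun s => ∑ i, ContinuousLinearMap.smulRightL ℝ E F (c i) (L s (b i)) := by
    ext s v
    conv_lhs => rw [← b.sum_repr v, map_sum]
    simp [c]
  rw [this]
  exact Finset.aestronglyMeasurable_fun_sum _ fun i _ =>
    (ContinuousLinearMap.continuous _).comp_aestronglyMeasurable (h (b i))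

lemma aestronglyMeasurable_fderiv_param [FiniteDimensional ℝ E] {f : α → E → F} {x : E}
    (hm : ∀ x, AEStronglyMeasurable (fun s => f s x) μ)
    (hd : ∀ᵐ s ∂μ, DifferentiableAt ℝ (f s) x) :
    AEStronglyMeasurable (fun s => fderiv ℝ (f s) x) μ := by
  refine aestronglyMeasurable_clm fun v => ?_
  refine aestronglyMeasurable_of_tendsto_ae atTop
    (f := fun (k : ℕ) s => (k : ℝ) • (f s (x + (k : ℝ)⁻¹ • v) - f s x))
    (fun k => ((hm _).sub (hm _)).const_smul _) ?_
  filter_upwards [hd] with s hs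
  exact hs.hasFDerivAt.lim v (by simpa using tendsto_natCast_atTop_atTop)

lemma HolderBound.integral [FiniteDimensional ℝ E] {β : ℝ} {n : ℕ} {f : α → E → F} {g : α → ℝ}
    (hg : Integrable g μ) (hm : ∀ x, AEStronglyMeasurable (fun s => f s x) μ)
    (hf : ∀ᵐ s ∂μ, HolderBound β n (g s) (f s)) :
    HolderBound β n (∫ s, g s ∂μ) (fun x => ∫ s, f s x ∂μ) := by
  have hb : ∀ x, ‖∫ s, f s x ∂μ‖ ≤ ∫ s, g s ∂μ := fun x =>
    norm_integral_le_of_norm_le hg (hf.mono fun s hs => hs.norm_le x)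
  have hint : ∀ x, Integrable (fun s => f s x) μ := fun x =>
    hg.mono' (hm x) (hf.mono fun s hs => hs.norm_le x)
  induction n generalizing F with
  | zero =>
    refine ⟨hb, fun x y => ?_⟩
    rw [← integral_sub (hint x) (hint y), ← integral_mul_const]
    exact norm_integral_le_of_norm_le (hg.mul_const _) (hf.mono fun s hs => hs.2 x y)
  | succ n ih =>
    have hm' : ∀ x, AEStronglyMeasurable (fun s => fderiv ℝ (f s) x) μ := fun x =>
      aestronglyMeasurable_fderiv_param hm (hf.mono fun s hs => hs.1 x)
    have hd : ∀ x, HasFDerivAt (fun x => ∫ s, f s x ∂μ) (∫ s, fderiv ℝ (f s) x ∂μ) x := fun x =>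
      hasFDerivAt_integral_of_dominated_of_fderiv_le univ_mem
        (F := fun x s => f s x) (F' := fun x s => fderiv ℝ (f s) x) (bound := g)
        (Eventually.of_forall hm) (hint x) (hm' x)
        (hf.mono fun s hs x _ => hs.2.2.norm_le x) hg
        (hf.mono fun s hs x _ => (hs.1 x).hasFDerivAt)
    have hfd : fderiv ℝ (fun x => ∫ s, f s x ∂μ) = fun x => ∫ s, fderiv ℝ (f s) x ∂μ :=
      funext fun x => (hd x).fderiv
    refine ⟨fun x => (hd x).differentiableAt, hb, ?_⟩
    rw [hfd]
    have hf' : ∀ᵐ s ∂μ, HolderBound β n (g s) (fderiv ℝ (f s)) := hf.mono fun s hs => hs.2.2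
    exact ih hm' hf' (fun x =>
      norm_integral_le_of_norm_le hg (hf'.mono fun s hs => hs.norm_le x))
      (fun x => hg.mono' (hm' x) (hf'.mono fun s hs => hs.norm_le x))

end ParametricIntegral

lemma det_id_add_pos {E : Type*} [NormedAddCommGroup E] [NormedSpace ℝ E] [FiniteDimensional ℝ E]
    {L : E →L[ℝ] E} (hL : ‖L‖ < 1) :
    0 < LinearMap.det ((.id ℝ E + L : E →L[ℝ] E) : E →ₗ[ℝ] E) := by
  have hne : ∀ r ∈ Icc (0 : ℝ) 1, (ContinuousLinearMap.id ℝ E + r • L).det ≠ 0 := by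
    intro r hr h0
    obtain ⟨x, hx, hx0⟩ := (Submodule.ne_bot_iff _).1
      (LinearMap.bot_lt_ker_of_det_eq_zero h0).ne'
    have hx' : x + r • L x = 0 := hx
    have h2 : ‖x‖ = ‖r • L x‖ := by
      conv_lhs => rw [eq_neg_of_add_eq_zero_left hx', norm_neg]
    have h1 : ‖x‖ ≤ ‖L‖ * ‖x‖ := by
      calc ‖x‖ = ‖r • L x‖ := h2
        _ = r * ‖L x‖ := by rw [norm_smul, Real.norm_of_nonneg hr.1]
        _ ≤ 1 * ‖L x‖ := by gcongr; exact hr.2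
        _ ≤ ‖L‖ * ‖x‖ := by rw [one_mul]; exact L.le_opNorm x
    nlinarith [norm_pos_iff.2 hx0]
  have hc : Continuous fun r : ℝ => (ContinuousLinearMap.id ℝ E + r • L).det :=
    ContinuousLinearMap.continuous_det.comp (by fun_prop)
  have h0 : (ContinuousLinearMap.id ℝ E + (0 : ℝ) • L).det = 1 := by
    rw [zero_smul, add_zero]; exact LinearMap.det_id
  by_contra! h
  obtain ⟨r, hr, hzero⟩ := intermediate_value_Icc' zero_le_one hc.continuousOn
    (show (0 : ℝ) ∈ Icc _ _ from ⟨by simp only [one_smul]; exact h, by rw [h0]; exact zero_le_one⟩)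
  exact hne r hr hzero

/-- To propagate a property along `[0,1]` it suffices to propagate it along intervals on which
the integral of `g` is small. -/
lemma Icc_induction_of_integral_le {g : ℝ → ℝ} (hg : IntegrableOn g (Icc 0 1)) {c : ℝ}
    (hc : 0 < c) {P : ℝ → Prop} (h0 : P 0)
    (hstep : ∀ a b, 0 ≤ a → a ≤ b → b ≤ 1 → ∫ s in a..b, g s ≤ c → P a → P b) :
    ∀ t ∈ Icc (0 : ℝ) 1, P t := by
  have hcont : ContinuousOn (fun t => ∫ s in (0 : ℝ)..t, g s) (Icc 0 1) := by
    simpa [uIcc_of_le] using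
      intervalIntegral.continuousOn_primitive_interval (a := 0) (b := 1) (by simpa [uIcc_of_le])
  obtain ⟨δ, hδ, hδ'⟩ := Metric.uniformContinuousOn_iff.1
    (isCompact_Icc.uniformContinuousOn_of_continuous hcont) c hc
  intro t ht
  obtain ⟨N, hN⟩ := exists_nat_gt (1 / δ)
  have hNpos : (0 : ℝ) < N := lt_trans (by positivity) hN
  have hk : ∀ k : ℕ, k ≤ N → P (k / N * t) := by
    intro k
    induction k with
    | zero => intro _; simpa using h0
    | succ k ih =>
      intro hk
      have hk' : ((k + 1 : ℕ) : ℝ) ≤ N := by exact_mod_cast hk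
      have hdiv : ((k + 1 : ℕ) : ℝ) / N ≤ 1 := (div_le_one hNpos).2 hk'
      have hlt : (k : ℝ) / N ≤ ((k + 1 : ℕ) : ℝ) / N := by gcongr; simp
      have ha0 : 0 ≤ (k : ℝ) / N * t := mul_nonneg (by positivity) ht.1
      have hab : (k : ℝ) / N * t ≤ ((k + 1 : ℕ) : ℝ) / N * t :=
        mul_le_mul_of_nonneg_right hlt ht.1
      have hb1 : ((k + 1 : ℕ) : ℝ) / N * t ≤ 1 := mul_le_one₀ hdiv ht.1 ht.2
      refine hstep _ _ ha0 hab hb1 ?_ (ih (by omega))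
      have hd : dist (((k + 1 : ℕ) : ℝ) / N * t) ((k : ℝ) / N * t) < δ := by
        rw [Real.dist_eq, abs_of_nonneg (sub_nonneg.2 hab)]
        have : ((k + 1 : ℕ) : ℝ) / N * t - (k : ℝ) / N * t = t / N := by
          push_cast; field_simp; ring
        rw [this, div_lt_iff₀ hNpos]
        have := (div_lt_iff₀ hδ).1 hN
        linarith [ht.2]
      have h1 := hδ' _ ⟨ha0.trans hab, hb1⟩ _ ⟨ha0, hab.trans hb1⟩ hd
      have hi : ∀ r ∈ Icc (0 : ℝ) 1, IntervalIntegrable g volume 0 r := fun r hr =>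
        (intervalIntegrable_iff_integrableOn_Icc_of_le hr.1).2
          (hg.mono_set (Icc_subset_Icc_right hr.2))
      rw [Real.dist_eq, intervalIntegral.integral_interval_sub_left
        (hi _ ⟨ha0.trans hab, hb1⟩) (hi _ ⟨ha0, hab.trans hb1⟩)] at h1
      exact (le_abs_self _).trans h1.le
  simpa [hNpos.ne'] using hk N le_rfl

section Flow

universe v

variable {E : Type v} [NormedAddCommGroup E] [NormedSpace ℝ E]
  {β : ℝ} {n : ℕ} {u : ℝ → E → E} {g : ℝ → ℝ} {a b : ℝ}

/-- A time-dependent vector field on `[a,b]` whose `C^{n,β}` bound at time `s` is `g s`, with `g`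
integrable. -/
structure IsHolderField (β : ℝ) (n : ℕ) (u : ℝ → E → E) (g : ℝ → ℝ) (a b : ℝ) : Prop where
  bound : ∀ s ∈ Icc a b, HolderBound β n (g s) (u s)
  meas : ∀ x, AEStronglyMeasurable (fun s => u s x) (volume.restrict (Icc a b))
  integrable : IntegrableOn g (Icc a b)

namespace IsHolderField

lemma mono (hu : IsHolderField β n u g a b) {a' b' : ℝ} (h : Icc a' b' ⊆ Icc a b) :
    IsHolderField β n u g a' b' :=
  ⟨fun s hs => hu.bound s (h hs), fun x => (hu.meas x).mono_measure (Measure.restrict_mono_set _ h),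
    hu.integrable.mono_set h⟩

lemma intervalIntegrable (hu : IsHolderField β n u g a b) (hab : a ≤ b) :
    IntervalIntegrable g volume a b :=
  (intervalIntegrable_iff_integrableOn_Icc_of_le hab).2 hu.integrable

lemma nonneg (hu : IsHolderField β n u g a b) {s : ℝ} (hs : s ∈ Icc a b) : 0 ≤ g s :=
  (hu.bound s hs).nonneg

lemma integral_mono (hu : IsHolderField β n u g a b) {t : ℝ} (ht : t ∈ Icc a b) :
    ∫ s in a..t, g s ≤ ∫ s in a..b, g s := by
  refine intervalIntegral.integral_mono_interval le_rfl ht.1 ht.2 ?_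
    (hu.intervalIntegrable (ht.1.trans ht.2))
  filter_upwards [ae_restrict_mem measurableSet_Ioc] with s hs
  exact hu.nonneg (Ioc_subset_Icc_self hs)

lemma lipschitz (hn : 1 ≤ n) (hu : IsHolderField β n u g a b) {s : ℝ} (hs : s ∈ Icc a b)
    (x y : E) : ‖u s x - u s y‖ ≤ g s * ‖x - y‖ := by
  obtain ⟨n, rfl⟩ := Nat.exists_eq_add_of_le' hn
  exact (hu.bound s hs).lipschitz x y

lemma integrableOn_comp (hβ0 : 0 < β) (hu : IsHolderField β n u g a b) {φ : ℝ → E}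
    (hφ : AEStronglyMeasurable φ (volume.restrict (Icc a b))) :
    IntegrableOn (fun s => u s (φ s)) (Icc a b) := by
  have hae : ∀ᵐ s ∂volume.restrict (Icc a b), HolderBound β n (g s) (u s) := by
    filter_upwards [ae_restrict_mem measurableSet_Icc] with s hs using hu.bound s hs
  exact hu.integrable.mono' (aestronglyMeasurable_comp_of_continuous hu.meas
    (hae.mono fun s hs => ((holderBound_iff hβ0).1 hs).1.continuous) hφ)
    (hae.mono fun s hs => hs.norm_le _)

lemma integral_comp [FiniteDimensional ℝ E] (hβ0 : 0 < β) (hβ1 : β ≤ 1) (hn : 1 ≤ n)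
    (hu : IsHolderField β n u g a b) {Φ : ℝ → E → E} {M : ℝ}
    (hΦ : ∀ t ∈ Icc a b, HolderBound β n M (fun x => Φ t x - x))
    (hm : ∀ x, AEStronglyMeasurable (fun s => Φ s x) (volume.restrict (Icc a b))) (hab : a ≤ b) :
    HolderBound β n (compConst n M * ∫ s in a..b, g s) (fun x => ∫ s in a..b, u s (Φ s x)) := by
  simp only [intervalIntegral.integral_of_le hab, ← integral_Icc_eq_integral_Ioc]
  rw [← integral_const_mul]
  refine HolderBound.integral (hu.integrable.const_mul _)
    (fun x => (hu.integrableOn_comp hβ0 (hm x)).aestronglyMeasurable) ?_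
  filter_upwards [ae_restrict_mem measurableSet_Icc] with s hs
  simpa using (hu.bound s hs).comp_id_add' hβ0 hβ1 hn (hΦ s hs)

lemma norm_integral_sub_le (hn : 1 ≤ n) (hu : IsHolderField β n u g a b) {φ ψ : ℝ → E}
    (hφ : IntegrableOn (fun s => u s (φ s)) (Icc a b))
    (hψ : IntegrableOn (fun s => u s (ψ s)) (Icc a b)) {η : ℝ}
    (h : ∀ s ∈ Icc a b, ‖φ s - ψ s‖ ≤ η) {t : ℝ} (ht : t ∈ Icc a b) :
    ‖(∫ s in a..t, u s (φ s)) - ∫ s in a..t, u s (ψ s)‖ ≤ (∫ s in a..b, g s) * η := by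
  have hsub : Icc a t ⊆ Icc a b := Icc_subset_Icc_right ht.2
  have hη : 0 ≤ η := (norm_nonneg _).trans (h t ht)
  rw [← intervalIntegral.integral_sub
    ((intervalIntegrable_iff_integrableOn_Icc_of_le ht.1).2 (hφ.mono_set hsub))
    ((intervalIntegrable_iff_integrableOn_Icc_of_le ht.1).2 (hψ.mono_set hsub))]
  refine (intervalIntegral.norm_integral_le_of_norm_le (g := fun s => g s * η) ht.1
    (Eventually.of_forall fun s hs => ?_)
    (((hu.mono hsub).intervalIntegrable ht.1).mul_const η)).trans ?_
  · have hs' := hsub (Ioc_subset_Icc_self hs)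
    exact (hu.lipschitz hn hs' _ _).trans
      (mul_le_mul_of_nonneg_left (h s hs') (hu.nonneg hs'))
  · rw [intervalIntegral.integral_mul_const]
    exact mul_le_mul_of_nonneg_right (hu.integral_mono ht) hη

/-- Local uniqueness of integral curves. -/
lemma eq_of_integral_le (hn : 1 ≤ n) (hu : IsHolderField β n u g a b) (hab : a ≤ b)
    (hsmall : ∫ s in a..b, g s ≤ 1 / 2) {φ ψ : ℝ → E}
    (hφ : IntegrableOn (fun s => u s (φ s)) (Icc a b))
    (hψ : IntegrableOn (fun s => u s (ψ s)) (Icc a b))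
    (hφeq : ∀ t ∈ Icc a b, φ t = φ a + ∫ s in a..t, u s (φ s))
    (hψeq : ∀ t ∈ Icc a b, ψ t = ψ a + ∫ s in a..t, u s (ψ s)) (h : φ a = ψ a) : φ b = ψ b := by
  have hdiff : ∀ t ∈ Icc a b,
      φ t - ψ t = (∫ s in a..t, u s (φ s)) - ∫ s in a..t, u s (ψ s) := fun t ht => by
    rw [hφeq t ht, hψeq t ht, h, add_sub_add_left_eq_sub]
  have hcont : ContinuousOn (fun t => ‖φ t - ψ t‖) (Icc a b) := by
    rw [← uIcc_of_le hab] at hφ hψ hdiff ⊢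
    exact (((intervalIntegral.continuousOn_primitive_interval hφ).sub
      (intervalIntegral.continuousOn_primitive_interval hψ)).congr hdiff).norm
  obtain ⟨t, ht, hmax⟩ := isCompact_Icc.exists_isMaxOn (nonempty_Icc.2 hab) hcont
  have h1 := hu.norm_integral_sub_le hn hφ hψ (fun s hs => hmax hs) ht
  rw [← hdiff t ht] at h1
  have h2 : ‖φ b - ψ b‖ ≤ ‖φ t - ψ t‖ := hmax (right_mem_Icc.2 hab)
  have h3 : ‖φ b - ψ b‖ ≤ 0 := by nlinarith [norm_nonneg (φ t - ψ t)]
  exact sub_eq_zero.1 (norm_le_zero_iff.1 h3)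

end IsHolderField

/-- `Φ` is a flow of `u` on `[a,b]` by orientation preserving `C^{n,β}` perturbations of the
identity, with uniform bound `M`. -/
structure IsHolderFlow (β : ℝ) (n : ℕ) (u : ℝ → E → E) (M a b : ℝ) (Φ : ℝ → E → E) : Prop where
  integrable : ∀ x, IntegrableOn (fun s => u s (Φ s x)) (Icc a b)
  eq : ∀ t ∈ Icc a b, ∀ x, Φ t x = x + ∫ s in a..t, u s (Φ s x)
  bound : ∀ t ∈ Icc a b, HolderBound β n M (fun x => Φ t x - x)
  det_pos : ∀ t ∈ Icc a b, ∀ x, 0 < LinearMap.det (fderiv ℝ (Φ t) x : E →ₗ[ℝ] E)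

/-- Picard iterates for the flow of `u` starting at time `a`. -/
noncomputable def picardFlow (u : ℝ → E → E) (a : ℝ) : ℕ → ℝ → E → E
  | 0 => fun _ x => x
  | k + 1 => fun t x => x + ∫ s in a..t, u s (picardFlow u a k s x)

lemma continuousOn_add_primitive {f : ℝ → E} (hf : IntegrableOn f (Icc a b)) (hab : a ≤ b) (x : E) :
    ContinuousOn (fun t => x + ∫ s in a..t, f s) (Icc a b) := by
  rw [← uIcc_of_le hab] at hf ⊢
  exact continuousOn_const.add (intervalIntegral.continuousOn_primitive_interval hf)

lemma IsHolderField.picardFlow_bound [FiniteDimensional ℝ E] (hβ0 : 0 < β) (hβ1 : β ≤ 1)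
    (hn : 1 ≤ n) (hu : IsHolderField β n u g a b) (hab : a ≤ b)
    (hsmall : compConst n (1 / 2) * ∫ s in a..b, g s ≤ 1 / 2) (k : ℕ) :
    (∀ t ∈ Icc a b, HolderBound β n (1 / 2) (fun x => picardFlow u a k t x - x)) ∧
      ∀ x, AEStronglyMeasurable (fun s => picardFlow u a k s x) (volume.restrict (Icc a b)) := by
  induction k with
  | zero =>
    refine ⟨fun t _ => ?_, fun x => aestronglyMeasurable_const⟩
    simpa [picardFlow] using (holderBound_const (0 : E)).mono (by simp)
  | succ k ih =>
    refine ⟨fun t ht => ?_, fun x => ?_⟩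
    · have hsub : Icc a t ⊆ Icc a b := Icc_subset_Icc_right ht.2
      simp only [picardFlow, add_sub_cancel_left]
      refine ((hu.mono hsub).integral_comp hβ0 hβ1 hn (fun s hs => ih.1 s (hsub hs))
        (fun x => (ih.2 x).mono_measure (Measure.restrict_mono_set _ hsub)) ht.1).mono
        (le_trans ?_ hsmall)
      have := one_le_compConst n (M := 1 / 2) (by norm_num)
      gcongr
      exact hu.integral_mono ht
    · exact (continuousOn_add_primitive (hu.integrableOn_comp hβ0 (ih.2 x)) hab
        x).aestronglyMeasurable measurableSet_Icc

/-- Short time existence of flows. -/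
lemma IsHolderField.exists_flow_of_integral_le [FiniteDimensional ℝ E] (hβ0 : 0 < β)
    (hβ1 : β ≤ 1) (hn : 1 ≤ n) (hu : IsHolderField β n u g a b) (hab : a ≤ b)
    (hsmall : compConst n (1 / 2) * ∫ s in a..b, g s ≤ 1 / 2) :
    ∃ Φ, IsHolderFlow β n u (1 / 2) a b Φ := by
  have := FiniteDimensional.complete ℝ E
  have hP := hu.picardFlow_bound hβ0 hβ1 hn hab hsmall
  have hg0 : 0 ≤ ∫ s in a..b, g s :=
    intervalIntegral.integral_nonneg hab fun s hs => hu.nonneg hs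
  have hg2 : ∫ s in a..b, g s ≤ 1 / 2 := by
    have := one_le_compConst n (M := 1 / 2) (by norm_num)
    nlinarith
  have hI : ∀ k x, IntegrableOn (fun s => u s (picardFlow u a k s x)) (Icc a b) := fun k x =>
    hu.integrableOn_comp hβ0 ((hP k).2 x)
  have hgeo : ∀ k, ∀ t ∈ Icc a b, ∀ x,
      dist (picardFlow u a k t x) (picardFlow u a (k + 1) t x) ≤ 1 / 2 * (1 / 2) ^ k := by
    intro k
    induction k with
    | zero =>
      intro t ht x
      rw [dist_eq_norm, norm_sub_rev]
      simpa [picardFlow] using ((hP 1).1 t ht).norm_le x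
    | succ k ih =>
      intro t ht x
      have := hu.norm_integral_sub_le hn (hI k x) (hI (k + 1) x)
        (fun s hs => (dist_eq_norm _ _).symm.trans_le (ih s hs x)) ht
      rw [dist_eq_norm]
      conv_lhs => rw [picardFlow, picardFlow, add_sub_add_left_eq_sub]
      refine this.trans ?_
      rw [pow_succ]
      nlinarith [pow_pos (show (0 : ℝ) < 1 / 2 by norm_num) k]
  have hlim : ∀ t x, ∃ y, t ∈ Icc a b →
      Tendsto (fun k => picardFlow u a k t x) atTop (𝓝 y) := by
    intro t x
    by_cases ht : t ∈ Icc a b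
    · obtain ⟨y, hy⟩ := cauchySeq_tendsto_of_complete
        (cauchySeq_of_le_geometric (1 / 2) (1 / 2) (by norm_num) fun k => hgeo k t ht x)
      exact ⟨y, fun _ => hy⟩
    · exact ⟨0, fun h => absurd h ht⟩
  choose Φ hΦ using hlim
  have hdist : ∀ k, ∀ t ∈ Icc a b, ∀ x, dist (picardFlow u a k t x) (Φ t x) ≤ (1 / 2) ^ k := by
    intro k t ht x
    refine (dist_le_of_le_geometric_of_tendsto (1 / 2) (1 / 2) (by norm_num)
      (fun k => hgeo k t ht x) (hΦ t x ht) k).trans_eq ?_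
    field_simp; norm_num
  have hpow : Tendsto (fun k : ℕ => (1 / 2 : ℝ) ^ k) atTop (𝓝 0) :=
    tendsto_pow_atTop_nhds_zero_of_lt_one (by norm_num) (by norm_num)
  have hbd : ∀ t ∈ Icc a b, HolderBound β n (1 / 2) (fun x => Φ t x - x) := by
    intro t ht
    refine HolderBound.of_tendstoUniformly hβ0 hβ1 (fun k => (hP k).1 t ht) ?_
    rw [Metric.tendstoUniformly_iff]
    intro ε hε
    filter_upwards [hpow.eventually_lt_const hε] with k hk x
    rw [dist_sub_right, dist_comm]
    exact (hdist k t ht x).trans_lt hk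
  have hmeas : ∀ x, AEStronglyMeasurable (fun s => Φ s x) (volume.restrict (Icc a b)) := fun x =>
    aestronglyMeasurable_of_tendsto_ae atTop (fun k => (hP k).2 x) (by
      filter_upwards [ae_restrict_mem measurableSet_Icc] with s hs using hΦ s x hs)
  have hint : ∀ x, IntegrableOn (fun s => u s (Φ s x)) (Icc a b) := fun x =>
    hu.integrableOn_comp hβ0 (hmeas x)
  refine ⟨Φ, hint, fun t ht x => ?_, hbd, fun t ht x => ?_⟩
  · refine tendsto_nhds_unique ((tendsto_add_atTop_iff_nat 1).2 (hΦ t x ht)) ?_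
    refine tendsto_const_nhds.add (tendsto_iff_norm_sub_tendsto_zero.2 ?_)
    refine squeeze_zero (fun _ => norm_nonneg _) (fun k => hu.norm_integral_sub_le hn (hI k x)
      (hint x) (fun s hs => (dist_eq_norm _ _).symm.trans_le (hdist k s hs x)) ht) ?_
    simpa using hpow.const_mul (∫ s in a..b, g s)
  · obtain ⟨m, rfl⟩ := Nat.exists_eq_add_of_le' hn
    have h := hbd t ht
    have hd : HasFDerivAt (Φ t) (.id ℝ E + fderiv ℝ (fun x => Φ t x - x) x) x := by
      convert (hasFDerivAt_id x).add (h.1 x).hasFDerivAt using 1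
      ext1 y
      simp
    rw [hd.fderiv]
    exact det_id_add_pos ((h.2.2.norm_le x).trans_lt (by norm_num))

lemma IsHolderFlow.differentiable (hn : 1 ≤ n) {M : ℝ} {Φ : ℝ → E → E}
    (h : IsHolderFlow β n u M a b Φ) {t : ℝ} (ht : t ∈ Icc a b) : Differentiable ℝ (Φ t) := by
  obtain ⟨n, rfl⟩ := Nat.exists_eq_add_of_le' hn
  simpa using (h.bound t ht).1.add differentiable_id

/-- Concatenation of flows. -/
lemma IsHolderFlow.trans (hβ0 : 0 < β) (hβ1 : β ≤ 1) (hn : 1 ≤ n) {c M M' : ℝ}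
    {Φ Ψ : ℝ → E → E} (hab : a ≤ b) (hbc : b ≤ c) (hΦ : IsHolderFlow β n u M a b Φ)
    (hΨ : IsHolderFlow β n u M' b c Ψ) :
    IsHolderFlow β n u (compConst n M * M' + M) a c
      (fun t x => if t ≤ b then Φ t x else Ψ t (Φ b x)) := by
  have hb : b ∈ Icc a b := right_mem_Icc.2 hab
  have hΨb : ∀ x, Ψ b x = x := fun x => by simpa using hΨ.eq b (left_mem_Icc.2 hbc) x
  have hM : 0 ≤ M := (hΦ.bound b hb).nonneg
  have hM' : 0 ≤ M' := (hΨ.bound b (left_mem_Icc.2 hbc)).nonneg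
  have hC := one_le_compConst n hM
  have hleft : ∀ x, EqOn (fun s => u s (if s ≤ b then Φ s x else Ψ s (Φ b x)))
      (fun s => u s (Φ s x)) (Icc a b) := fun x s hs => by simp [hs.2]
  have hright : ∀ x, EqOn (fun s => u s (if s ≤ b then Φ s x else Ψ s (Φ b x)))
      (fun s => u s (Ψ s (Φ b x))) (Icc b c) := fun x s hs => by
    rcases hs.1.eq_or_lt with rfl | h
    · simp [hΨb]
    · simp [h.not_ge]
  have hintl : ∀ x, IntegrableOn (fun s => u s (if s ≤ b then Φ s x else Ψ s (Φ b x)))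
      (Icc a b) := fun x => (hΦ.integrable x).congr_fun (hleft x).symm measurableSet_Icc
  have hintr : ∀ x, IntegrableOn (fun s => u s (if s ≤ b then Φ s x else Ψ s (Φ b x)))
      (Icc b c) := fun x => (hΨ.integrable _).congr_fun (hright x).symm measurableSet_Icc
  have heql : ∀ t ∈ Icc a b, ∀ x, ∫ s in a..t, u s (if s ≤ b then Φ s x else Ψ s (Φ b x)) =
      ∫ s in a..t, u s (Φ s x) := fun t ht x =>
    intervalIntegral.integral_congr fun s hs => hleft x (by
      rw [uIcc_of_le ht.1] at hs; exact ⟨hs.1, hs.2.trans ht.2⟩)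
  refine ⟨fun x => ?_, fun t ht x => ?_, fun t ht => ?_, fun t ht x => ?_⟩
  · rw [← Icc_union_Icc_eq_Icc hab hbc]
    exact (hintl x).union (hintr x)
  · by_cases h : t ≤ b
    · rw [if_pos h, heql t ⟨ht.1, h⟩, hΦ.eq t ⟨ht.1, h⟩]
    · have hbt : b ≤ t := (not_le.1 h).le
      rw [if_neg h, hΨ.eq t ⟨hbt, ht.2⟩]
      nth_rewrite 1 [hΦ.eq b hb x]
      rw [← intervalIntegral.integral_add_adjacent_intervals
        ((intervalIntegrable_iff_integrableOn_Icc_of_le hab).2 (hintl x))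
        ((intervalIntegrable_iff_integrableOn_Icc_of_le hbt).2
          ((hintr x).mono_set (Icc_subset_Icc_right ht.2))), heql b hb x, add_assoc]
      congr 2
      exact intervalIntegral.integral_congr fun s hs => (hright x (by
        rw [uIcc_of_le hbt] at hs; exact ⟨hs.1, hs.2.trans ht.2⟩)).symm
  · by_cases h : t ≤ b
    · simp only [if_pos h]
      exact (hΦ.bound t ⟨ht.1, h⟩).mono (by nlinarith)
    · simp only [if_neg h]
      have h1 := ((hΨ.bound t ⟨(not_le.1 h).le, ht.2⟩).comp_id_add' hβ0 hβ1 hn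
        (hΦ.bound b hb)).add (hΦ.bound b hb)
      simpa using h1
  · by_cases h : t ≤ b
    · simp only [if_pos h]
      exact hΦ.det_pos t ⟨ht.1, h⟩ x
    · simp only [if_neg h]
      have ht' : t ∈ Icc b c := ⟨(not_le.1 h).le, ht.2⟩
      have hcomp : fderiv ℝ (fun x => Ψ t (Φ b x)) x =
          (fderiv ℝ (Ψ t) (Φ b x)).comp (fderiv ℝ (Φ b) x) :=
        fderiv_comp x (hΨ.differentiable hn ht' _) (hΦ.differentiable hn hb x)
      rw [hcomp]
      refine lt_of_lt_of_eq ?_ (LinearMap.det_comp _ _).symm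
      exact mul_pos (hΨ.det_pos t ht' _) (hΦ.det_pos b hb x)

lemma IsHolderField.exists_flow [FiniteDimensional ℝ E] (hβ0 : 0 < β) (hβ1 : β ≤ 1)
    (hn : 1 ≤ n) (hu : IsHolderField β n u g 0 1) : ∃ M Φ, IsHolderFlow β n u M 0 1 Φ := by
  have hC := one_le_compConst n (M := 1 / 2) (by norm_num)
  refine Icc_induction_of_integral_le (P := fun t => ∃ M Φ, IsHolderFlow β n u M 0 t Φ)
    hu.integrable (c := 1 / (2 * compConst n (1 / 2))) (by positivity) ?_ ?_ 1 (by simp)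
  · refine ⟨0, fun _ x => x, fun x => by simp, fun t ht x => ?_, fun t _ => ?_, fun t _ x => ?_⟩
    · rw [Icc_self, mem_singleton_iff] at ht
      simp [ht]
    · simpa using holderBound_const (E := E) (0 : E)
    · simp
  · rintro a b ha hab hb hsmall ⟨M, Φ, hΦ⟩
    obtain ⟨Ψ, hΨ⟩ := (hu.mono (Icc_subset_Icc ha hb)).exists_flow_of_integral_le hβ0 hβ1 hn hab (by
      rw [le_div_iff₀ (by positivity)] at hsmall
      linarith)
    exact ⟨_, _, hΦ.trans hβ0 hβ1 hn ha hab hΨ⟩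

/-- Uniqueness of integral curves. -/
lemma IsHolderField.eqOn_of_integral_eq (hn : 1 ≤ n) (hu : IsHolderField β n u g 0 1)
    {φ ψ : ℝ → E} {x : E} (hφ : IntegrableOn (fun s => u s (φ s)) (Icc 0 1))
    (hψ : IntegrableOn (fun s => u s (ψ s)) (Icc 0 1))
    (hφeq : ∀ t ∈ Icc (0 : ℝ) 1, φ t = x + ∫ s in (0 : ℝ)..t, u s (φ s))
    (hψeq : ∀ t ∈ Icc (0 : ℝ) 1, ψ t = x + ∫ s in (0 : ℝ)..t, u s (ψ s)) :
    EqOn φ ψ (Icc 0 1) := by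
  have key : ∀ {φ : ℝ → E}, IntegrableOn (fun s => u s (φ s)) (Icc 0 1) →
      (∀ t ∈ Icc (0 : ℝ) 1, φ t = x + ∫ s in (0 : ℝ)..t, u s (φ s)) →
      ∀ {a b : ℝ}, 0 ≤ a → b ≤ 1 → ∀ t ∈ Icc a b, φ t = φ a + ∫ s in a..t, u s (φ s) := by
    intro φ hφ hφeq a b ha hb t ht
    have ht0 := ha.trans ht.1
    have ht1 := ht.2.trans hb
    rw [hφeq t ⟨ht0, ht1⟩, hφeq a ⟨ha, ht.1.trans ht1⟩, add_assoc,
      intervalIntegral.integral_add_adjacent_intervals]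
    · exact (intervalIntegrable_iff_integrableOn_Icc_of_le ha).2
        (hφ.mono_set (Icc_subset_Icc_right (ht.1.trans ht1)))
    · exact (intervalIntegrable_iff_integrableOn_Icc_of_le ht.1).2
        (hφ.mono_set (Icc_subset_Icc ha ht1))
  refine Icc_induction_of_integral_le (P := fun t => φ t = ψ t) hu.integrable
    (c := 1 / 2) (by norm_num) ?_ ?_
  · rw [hφeq 0 (by simp), hψeq 0 (by simp)]
    simp
  · intro a b ha hab hb hsmall h
    have hsub := Icc_subset_Icc ha hb
    exact (hu.mono hsub).eq_of_integral_le hn hab hsmall (hφ.mono_set hsub) (hψ.mono_set hsub)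
      (key hφ hφeq ha hb) (key hψ hψeq ha hb) h

lemma IsHolderFlow.aestronglyMeasurable {M : ℝ} {Φ : ℝ → E → E} (hab : a ≤ b)
    (h : IsHolderFlow β n u M a b Φ) (x : E) :
    AEStronglyMeasurable (fun s => Φ s x) (volume.restrict (Icc a b)) :=
  ((continuousOn_add_primitive (h.integrable x) hab x).congr
    fun t ht => h.eq t ht x).aestronglyMeasurable measurableSet_Icc

lemma IsHolderFlow.holderBound_sub [FiniteDimensional ℝ E] (hβ0 : 0 < β) (hβ1 : β ≤ 1)
    (hn : 1 ≤ n) (hu : IsHolderField β n u g a b) {M : ℝ} {Φ : ℝ → E → E} (hab : a ≤ b)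
    (h : IsHolderFlow β n u M a b Φ) {s t : ℝ} (has : a ≤ s) (hst : s ≤ t) (htb : t ≤ b) :
    HolderBound β n (compConst n M * ∫ r in s..t, g r) (fun x => Φ t x - Φ s x) := by
  have hsub := Icc_subset_Icc has htb
  have : (fun x => Φ t x - Φ s x) = fun x => ∫ r in s..t, u r (Φ r x) := by
    ext1 x
    rw [h.eq t ⟨has.trans hst, htb⟩, h.eq s ⟨has, hst.trans htb⟩, add_sub_add_left_eq_sub]
    refine intervalIntegral.integral_interval_sub_left ?_ ?_
    · exact (intervalIntegrable_iff_integrableOn_Icc_of_le (has.trans hst)).2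
        ((h.integrable x).mono_set (Icc_subset_Icc_right htb))
    · exact (intervalIntegrable_iff_integrableOn_Icc_of_le has).2
        ((h.integrable x).mono_set (Icc_subset_Icc_right (hst.trans htb)))
  rw [this]
  exact (hu.mono hsub).integral_comp hβ0 hβ1 hn (fun r hr => h.bound r (hsub hr))
    (fun x => (h.aestronglyMeasurable hab x).mono_measure (Measure.restrict_mono_set _ hsub)) hst

lemma IsHolderFlow.tendsto_sub [ProperSpace E] (hu : IsHolderField β n u g a b)
    (h0 : ∀ s ∈ Icc a b, Tendsto (u s) (cocompact E) (𝓝 0)) {M : ℝ} {Φ : ℝ → E → E}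
    (h : IsHolderFlow β n u M a b Φ) {t : ℝ} (ht : t ∈ Icc a b) :
    Tendsto (fun x => Φ t x - x) (cocompact E) (𝓝 0) := by
  have hsub : Icc a t ⊆ Icc a b := Icc_subset_Icc_right ht.2
  have heq : (fun x => Φ t x - x) = fun x => ∫ s in Icc a t, u s (Φ s x) := by
    ext1 x
    rw [h.eq t ht, add_sub_cancel_left, intervalIntegral.integral_of_le ht.1,
      integral_Icc_eq_integral_Ioc]
  have hmem : ∀ᵐ s ∂volume.restrict (Icc a t), s ∈ Icc a b := by
    filter_upwards [ae_restrict_mem measurableSet_Icc] with s hs using hsub hs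
  rw [heq, ← Metric.cobounded_eq_cocompact, ← comap_norm_atTop,
    ← integral_zero ℝ E (μ := volume.restrict (Icc a t))]
  refine tendsto_integral_filter_of_dominated_convergence g
    (Eventually.of_forall fun x => ((h.integrable x).mono_set hsub).aestronglyMeasurable)
    (Eventually.of_forall fun x => hmem.mono fun s hs => (hu.bound s hs).norm_le _)
    (hu.integrable.mono_set hsub) (hmem.mono fun s hs => ?_)
  refine (h0 s hs).comp ?_
  rw [comap_norm_atTop, ← Metric.cobounded_eq_cocompact, ← tendsto_norm_atTop_iff_cobounded]
  refine tendsto_atTop_mono (f := fun x => -M + ‖x‖) (fun x => ?_)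
    (tendsto_atTop_add_const_left _ _ tendsto_norm_cobounded_atTop)
  have h1 := (h.bound s hs).norm_le x
  have h2 := norm_sub_norm_le x (Φ s x)
  rw [norm_sub_rev] at h2
  linarith

end Flow

/-- existence and uniqueness of the flow; ODE closedness of
`C^{n,β}_0`: every pointwise time-dependent `C^{n,β}_0`-vector field `u` has a
unique pointwise flow `Φ` with `Φ(t,·) ∈ D^{n,β}(ℝ^d)` for all `t ∈ [0,1]` and
`t ↦ Φ(t,·) − Id` continuous `[0,1] → C^{n,β}_0(ℝ^d,ℝ^d)`. -/
theorem stmt14 (d n : ℕ) (hn : 1 ≤ n) (β : ℝ) (hβ0 : 0 < β) (hβ1 : β ≤ 1)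
    (u : ℝ → Euc d → Euc d) (hu : PointwiseVF d n β u) :
    ∃ Φ : ℝ → Euc d → Euc d,
      (IsPointwiseFlow u Φ ∧
        (∀ t ∈ Icc (0 : ℝ) 1, MemD d n β (Φ t)) ∧
        (∀ t₀ ∈ Icc (0 : ℝ) 1, ∀ ε > (0 : ℝ), ∃ δ > (0 : ℝ),
          ∀ t ∈ Icc (0 : ℝ) 1, |t - t₀| < δ →
            hnorm n β (fun x => Φ t x - Φ t₀ x) < ε)) ∧
      ∀ Φ' : ℝ → Euc d → Euc d,
        (IsPointwiseFlow u Φ' ∧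
          (∀ t ∈ Icc (0 : ℝ) 1, MemD d n β (Φ' t)) ∧
          (∀ t₀ ∈ Icc (0 : ℝ) 1, ∀ ε > (0 : ℝ), ∃ δ > (0 : ℝ),
            ∀ t ∈ Icc (0 : ℝ) 1, |t - t₀| < δ →
              hnorm n β (fun x => Φ' t x - Φ' t₀ x) < ε)) →
        ∀ t ∈ Icc (0 : ℝ) 1, ∀ x, Φ' t x = Φ t x := by
  have hfield : IsHolderField β n u (fun s => hnorm n β (u s)) 0 1 :=
    ⟨fun s hs => (hu.1 s hs).1.holderBound hβ0, hu.2.1, hu.2.2⟩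
  have h0 : ∀ s ∈ Icc (0 : ℝ) 1, Tendsto (u s) (cocompact (Euc d)) (𝓝 0) := fun s hs => by
    rw [tendsto_zero_iff_norm_tendsto_zero]
    simpa using (hu.1 s hs).2 0 (Nat.zero_le n)
  obtain ⟨M, Φ, hΦ⟩ := hfield.exists_flow hβ0 hβ1 hn
  refine ⟨Φ, ⟨fun x => ⟨(intervalIntegrable_iff_integrableOn_Icc_of_le zero_le_one).2
    (hΦ.integrable x), fun t ht => hΦ.eq t ht x⟩, fun t ht => ⟨⟨⟨?_, ?_⟩, fun l hl => ?_⟩,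
    hΦ.det_pos t ht⟩, fun t₀ ht₀ ε hε => ?_⟩, fun Φ' hΦ' t ht x => ?_⟩
  · exact ((holderBound_iff hβ0).1 (hΦ.bound t ht)).1
  · exact ((hΦ.bound t ht).eHnorm_le hβ0).trans_lt ENNReal.ofReal_lt_top
  · exact (hΦ.bound t ht).tendsto_iteratedFDeriv hβ0 hβ1 (hΦ.tendsto_sub hfield h0 ht) hl
  · have hle : ∀ s ∈ Icc (0 : ℝ) 1, ∀ t ∈ Icc (0 : ℝ) 1,
        hnorm n β (fun x => Φ t x - Φ s x) ≤
          |compConst n M * ∫ r in s..t, hnorm n β (u r)| := by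
      intro s hs t ht
      rcases le_total s t with h | h
      · exact ((hΦ.holderBound_sub hβ0 hβ1 hn hfield zero_le_one hs.1 h ht.2).hnorm_le
          hβ0).trans (le_abs_self _)
      · have h1 := (hΦ.holderBound_sub hβ0 hβ1 hn hfield zero_le_one ht.1 h hs.2).neg
        simp only [neg_sub] at h1
        rw [intervalIntegral.integral_symm, mul_neg, abs_neg]
        exact (h1.hnorm_le hβ0).trans (le_abs_self _)
    have hcont : ContinuousOn
        (fun t => |compConst n M * ∫ r in t₀..t, hnorm n β (u r)|) (Icc 0 1) := by
      refine (continuousOn_const.mul ?_).abs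
      have := intervalIntegral.continuousOn_primitive_interval' (a := t₀)
        (hfield.intervalIntegrable zero_le_one) (by rwa [uIcc_of_le zero_le_one])
      rwa [uIcc_of_le zero_le_one] at this
    obtain ⟨δ, hδ, hδ'⟩ := Metric.continuousOn_iff.1 hcont t₀ ht₀ ε hε
    refine ⟨δ, hδ, fun t ht htδ => (hle t₀ ht₀ t ht).trans_lt ?_⟩
    simpa using hδ' t ht (by rwa [Real.dist_eq])
  · exact hfield.eqOn_of_integral_eq hn
      ((intervalIntegrable_iff_integrableOn_Icc_of_le zero_le_one).1 (hΦ'.1 x).1)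
      (hΦ.integrable x) (hΦ'.1 x).2 (fun t ht => hΦ.eq t ht x) ht
end
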